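/- arXiv:1711.08396 — 4 statements merged into one kernel-verified Lean document; each statement's English description precedes it below -/
import Mathlib

section
/- Let n ≥ 1 and m ≥ 0 be integers and let F ∈ ℤ[x_0, …, x_n] be a nonzero homogeneous polynomial whose coefficients have gcd 1. Then there exists a constant C = C(F, m, n) > 0 such that for all real B ≥ 16, all real y with 16 ≤ y ≤ B^{1/(10(m+1)(n+1))}, and all real z ≥ 1: ∑ ( z + #{ p prime : p ≤ y, p ∣ F(x) } )^m ≤ C · B^{n+1} · ( z + log log y )^m, where the sum runs over primitive vectors x ∈ ℤ^{n+1} with max_i |x_i| ≤ B and F(x) ≠ 0. -/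
/-- Elementary symmetric sums of nonnegative reals are bounded by powers of the sum. -/
theorem Finset.sum_powersetCard_prod_le_sum_pow {α : Type*} (s : Finset α)
    (f : α → ℝ) (hf : ∀ a ∈ s, 0 ≤ f a) (k : ℕ) :
    ∑ t ∈ s.powersetCard k, ∏ a ∈ t, f a ≤ (∑ a ∈ s, f a) ^ k := by
  classical
  induction s using Finset.induction_on generalizing k with
  | empty =>
    cases k with
    | zero => simp
    | succ k => rw [Finset.powersetCard_eq_empty.2 (by simp)]; simp
  | insert a s ha ih =>
    have hfs : ∀ b ∈ s, 0 ≤ f b := fun b hb => hf b (Finset.mem_insert_of_mem hb)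
    have hfa : 0 ≤ f a := hf a (Finset.mem_insert_self a s)
    have hsum : 0 ≤ ∑ b ∈ s, f b := Finset.sum_nonneg hfs
    cases k with
    | zero => simp
    | succ k =>
      have hnot : ∀ t ∈ s.powersetCard k, a ∉ t := fun t ht hat =>
        ha ((Finset.mem_powersetCard.1 ht).1 hat)
      rw [Finset.powersetCard_succ_insert ha, Finset.sum_union, Finset.sum_image,
        Finset.sum_insert ha]
      · have h : ∑ t ∈ s.powersetCard k, ∏ b ∈ insert a t, f b
            = f a * ∑ t ∈ s.powersetCard k, ∏ b ∈ t, f b := by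
          rw [Finset.mul_sum]
          exact Finset.sum_congr rfl fun t ht => Finset.prod_insert (hnot t ht)
        rw [h]
        have h1 := ih hfs (k + 1)
        have h2 := mul_le_mul_of_nonneg_left (ih hfs k) hfa
        have h3 : (∑ b ∈ s, f b) ^ k ≤ (f a + ∑ b ∈ s, f b) ^ k :=
          pow_le_pow_left₀ hsum (by linarith) k
        have h4 := mul_le_mul_of_nonneg_left h3 (add_nonneg hfa hsum)
        calc _ ≤ (∑ b ∈ s, f b) ^ (k + 1) + f a * (∑ b ∈ s, f b) ^ k := add_le_add h1 h2
          _ = (f a + ∑ b ∈ s, f b) * (∑ b ∈ s, f b) ^ k := by ring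
          _ ≤ _ := by rw [pow_succ']; exact h4
      · intro t ht u hu htu
        rw [← Finset.erase_insert (hnot t ht), htu, Finset.erase_insert (hnot u hu)]
      · refine Finset.disjoint_left.2 fun t ht ht' => ?_
        obtain ⟨u, -, rfl⟩ := Finset.mem_image.1 ht'
        exact ha ((Finset.mem_powersetCard.1 ht).1 (Finset.mem_insert_self a u))

/-- The reciprocals of the primes in the dyadic block `[2 ^ j, 2 ^ (j + 1))` sum to `O(1 / j)`. -/
theorem sum_inv_primes_dyadic_le (j : ℕ) (hj : 1 ≤ j) (s : Finset ℕ)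
    (hs : ∀ p ∈ s, p.Prime ∧ Nat.log 2 p = j) :
    ∑ p ∈ s, (p : ℝ)⁻¹ ≤ 4 * (j : ℝ)⁻¹ := by
  have hj0 : (0 : ℝ) < j := by exact_mod_cast hj
  have hl2 : 0 < Real.log 2 := Real.log_pos one_lt_two
  have hpow : (0 : ℝ) < 2 ^ j := by positivity
  have hbd : ∀ p ∈ s, 2 ^ j ≤ p ∧ p < 2 ^ (j + 1) := by
    intro p hp
    obtain ⟨hpp, hpj⟩ := hs p hp
    subst hpj
    exact ⟨Nat.pow_log_le_self 2 hpp.ne_zero, Nat.lt_pow_succ_log_self one_lt_two p⟩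
  have hθ : ∑ p ∈ s, Real.log p ≤ Real.log 4 * 2 ^ (j + 1) := by
    refine le_trans ?_ (Chebyshev.theta_le_log4_mul_x (x := (2 : ℝ) ^ (j + 1)) (by positivity))
    rw [Chebyshev.theta_eq_sum_Icc]
    refine Finset.sum_le_sum_of_subset_of_nonneg ?_ fun p _ _ => Real.log_natCast_nonneg p
    intro p hp
    simp only [Finset.mem_filter, Finset.mem_Icc]
    refine ⟨⟨Nat.zero_le _, Nat.le_floor ?_⟩, (hs p hp).1⟩
    exact_mod_cast (hbd p hp).2.le
  have hterm : ∀ p ∈ s, (p : ℝ)⁻¹ ≤ Real.log p * (2 ^ j * (j * Real.log 2))⁻¹ := by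
    intro p hp
    have h1 : (2 : ℝ) ^ j ≤ p := by exact_mod_cast (hbd p hp).1
    have h2 : j * Real.log 2 ≤ Real.log p := by
      rw [← Real.log_pow]; exact Real.log_le_log hpow h1
    calc (p : ℝ)⁻¹ ≤ (2 ^ j)⁻¹ := inv_anti₀ hpow h1
      _ = (j * Real.log 2) * (2 ^ j * (j * Real.log 2))⁻¹ := by field_simp
      _ ≤ _ := by gcongr
  calc _ ≤ ∑ p ∈ s, Real.log p * (2 ^ j * (j * Real.log 2))⁻¹ := Finset.sum_le_sum hterm
    _ = (∑ p ∈ s, Real.log p) * (2 ^ j * (j * Real.log 2))⁻¹ := by rw [Finset.sum_mul]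
    _ ≤ (Real.log 4 * 2 ^ (j + 1)) * (2 ^ j * (j * Real.log 2))⁻¹ := by gcongr
    _ = _ := by
      rw [show (4 : ℝ) = 2 ^ 2 by norm_num, Real.log_pow]
      field_simp
      push_cast
      ring

/-- An upper bound of the order of magnitude in Mertens' second theorem. -/
theorem sum_inv_primes_le_log_log (y : ℝ) (hy : 2 ≤ y) :
    ∑ p ∈ (Finset.range (⌊y⌋₊ + 1)).filter Nat.Prime, (p : ℝ)⁻¹
      ≤ 4 * (2 + Real.log (Real.log y)) := by
  set N := ⌊y⌋₊ with hN
  have hN2 : 2 ≤ N := Nat.le_floor (by exact_mod_cast hy)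
  set J := Nat.log 2 N with hJ
  have hmaps : ∀ p ∈ (Finset.range (N + 1)).filter Nat.Prime, Nat.log 2 p ∈ Finset.Icc 1 J := by
    intro p hp
    simp only [Finset.mem_filter, Finset.mem_range] at hp
    exact Finset.mem_Icc.2 ⟨Nat.log_pos one_lt_two hp.2.two_le, Nat.log_mono_right (by omega)⟩
  rw [← Finset.sum_fiberwise_of_maps_to hmaps]
  have hblock : ∑ j ∈ Finset.Icc 1 J, ∑ p ∈ (Finset.range (N + 1)).filter Nat.Prime with
      Nat.log 2 p = j, (p : ℝ)⁻¹ ≤ ∑ j ∈ Finset.Icc 1 J, 4 * (j : ℝ)⁻¹ := by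
    refine Finset.sum_le_sum fun j hj => ?_
    refine sum_inv_primes_dyadic_le j (Finset.mem_Icc.1 hj).1 _ fun p hp => ?_
    simp only [Finset.mem_filter] at hp
    exact ⟨hp.1.2, hp.2⟩
  refine hblock.trans ?_
  rw [← Finset.mul_sum]
  have hharm : ∑ j ∈ Finset.Icc 1 J, (j : ℝ)⁻¹ ≤ 1 + Real.log J := by
    have := harmonic_le_one_add_log J
    rw [harmonic_eq_sum_Icc] at this
    push_cast at this
    exact this
  have hJ1 : 1 ≤ J := Nat.log_pos one_lt_two hN2
  have hJ0 : (0 : ℝ) < J := by exact_mod_cast hJ1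
  have hl2 : 0 < Real.log 2 := Real.log_pos one_lt_two
  have hJle : J * Real.log 2 ≤ Real.log y := by
    rw [← Real.log_pow]
    refine Real.log_le_log (by positivity) (le_trans ?_ (Nat.floor_le (by linarith : 0 ≤ y)))
    exact_mod_cast Nat.pow_log_le_self 2 (by omega)
  have hlogJ : Real.log J ≤ 1 + Real.log (Real.log y) := by
    have h1 := Real.log_le_log (by positivity) hJle
    rw [Real.log_mul hJ0.ne' hl2.ne'] at h1
    have h2 : -1 ≤ Real.log (Real.log 2) := by
      have h3 := Real.one_sub_inv_le_log_of_pos hl2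
      have h4 : (Real.log 2)⁻¹ ≤ 2 := by
        rw [inv_le_comm₀ hl2 two_pos]
        have := Real.log_two_gt_d9
        linarith
      linarith
    linarith
  linarith

/-- A primitive integer polynomial is nonzero modulo every prime. -/
theorem MvPolynomial.map_intCast_zmod_ne_zero {σ : Type*} (F : MvPolynomial σ ℤ)
    (hF : Finset.gcd F.support F.coeff = 1) (p : ℕ) [hp : Fact p.Prime] :
    MvPolynomial.map (Int.castRingHom (ZMod p)) F ≠ 0 := by
  intro h
  have hdvd : (p : ℤ) ∣ Finset.gcd F.support F.coeff := by
    refine Finset.dvd_gcd fun d _ => ?_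
    have := congrArg (MvPolynomial.coeff d) h
    rw [MvPolynomial.coeff_map, MvPolynomial.coeff_zero] at this
    exact (ZMod.intCast_zmod_eq_zero_iff_dvd _ _).1 this
  rw [hF] at hdvd
  exact hp.out.one_lt.ne' (by exact_mod_cast Int.natAbs_dvd_natAbs.2 hdvd |> Nat.dvd_one.1)

open Finset in
/-- A primitive integer polynomial has `O(p ^ n)` zeros modulo `p` in `n + 1` variables. -/
theorem MvPolynomial.card_zeros_zmod_le {n : ℕ} (F : MvPolynomial (Fin (n + 1)) ℤ)
    (hF : Finset.gcd F.support F.coeff = 1) (p : ℕ) [hp : Fact p.Prime] :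
    #{v : Fin (n + 1) → ZMod p | MvPolynomial.eval v (MvPolynomial.map (Int.castRingHom _) F) = 0}
      ≤ F.totalDegree * p ^ n := by
  set G := MvPolynomial.map (Int.castRingHom (ZMod p)) F with hG
  have hdeg : G.totalDegree ≤ F.totalDegree := Finset.sup_mono (MvPolynomial.support_map_subset _ _)
  have h := MvPolynomial.schwartz_zippel_totalDegree (F.map_intCast_zmod_ne_zero hF p)
    (Finset.univ : Finset (ZMod p))
  rw [Fintype.piFinset_univ, Finset.card_univ, ZMod.card, ← hG] at h
  have hp0 : (0 : ℚ≥0) < p := by exact_mod_cast hp.out.pos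
  rw [div_le_div_iff₀ (by positivity) hp0, pow_succ, ← mul_assoc] at h
  have h' := le_of_mul_le_mul_right h hp0
  have h'' : #{v : Fin (n + 1) → ZMod p | MvPolynomial.eval v G = 0} ≤ G.totalDegree * p ^ n := by
    exact_mod_cast h'
  exact h''.trans (Nat.mul_le_mul_right _ hdeg)

open Finset in
/-- A residue class modulo `q ≤ N` has at most `4 * N / q` members in `[-N, N]`. -/
theorem Int.card_Ico_filter_dvd_sub_le (N q : ℕ) (hq : 0 < q) (hqN : q ≤ N) (v : ℤ) :
    (#{t ∈ Finset.Ico (-(N : ℤ)) (N + 1) | (q : ℤ) ∣ t - v} : ℝ) ≤ 4 * N / q := by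
  have hq0 : (0 : ℤ) < q := by exact_mod_cast hq
  have hqQ : (0 : ℚ) < q := by exact_mod_cast hq
  have h := Int.Ico_filter_modEq_card (-(N : ℤ)) (N + 1) hq0 v
  have heq : #{t ∈ Finset.Ico (-(N : ℤ)) (N + 1) | (q : ℤ) ∣ t - v}
      = #{t ∈ Finset.Ico (-(N : ℤ)) (N + 1) | t ≡ v [ZMOD q]} := by
    congr 1
    refine Finset.filter_congr fun t _ => ?_
    rw [Int.modEq_comm, Int.modEq_iff_dvd]
  have hle : (#{t ∈ Finset.Ico (-(N : ℤ)) (N + 1) | (q : ℤ) ∣ t - v} : ℚ) ≤ 4 * N / q := by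
    rw [heq, show ((#{t ∈ Finset.Ico (-(N : ℤ)) (N + 1) | t ≡ v [ZMOD q]} : ℕ) : ℚ)
      = ((#{t ∈ Finset.Ico (-(N : ℤ)) (N + 1) | t ≡ v [ZMOD q]} : ℤ) : ℚ) by push_cast; rfl, h]
    push_cast
    refine max_le ?_ (by positivity)
    have h1 := Int.ceil_lt_add_one (((N : ℚ) + 1 - v) / q)
    have h2 := Int.le_ceil ((-(N : ℚ) - v) / q)
    have hN : (1 : ℚ) ≤ N := by exact_mod_cast (by omega : 1 ≤ N)
    have hqN' : (q : ℚ) ≤ N := by exact_mod_cast hqN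
    have h3 : ((N : ℚ) + 1 - v) / q + 1 - (-(N : ℚ) - v) / q ≤ 4 * N / q := by
      rw [div_add_one hqQ.ne', ← sub_div]
      gcongr
      linarith
    linarith
  have : (((#{t ∈ Finset.Ico (-(N : ℤ)) (N + 1) | (q : ℤ) ∣ t - v} : ℚ)) : ℝ)
      ≤ ((4 * N / q : ℚ) : ℝ) := by exact_mod_cast hle
  push_cast at this
  exact this

open Finset in
/-- The number of integer points of a box at which a primitive polynomial is divisible by all
members of a finite family of distinct primes whose product does not exceed the side length. -/
theorem MvPolynomial.card_box_forall_prime_dvd_le {n : ℕ} (F : MvPolynomial (Fin (n + 1)) ℤ)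
    (hF : Finset.gcd F.support F.coeff = 1) (N : ℕ) (S : Finset ℕ) (hS : ∀ p ∈ S, p.Prime)
    (hSN : ∏ p ∈ S, p ≤ N) :
    (#{x ∈ Fintype.piFinset fun _ : Fin (n + 1) => Finset.Ico (-(N : ℤ)) (N + 1) |
        ∀ p ∈ S, (p : ℤ) ∣ MvPolynomial.eval x F} : ℝ)
      ≤ (4 * N) ^ (n + 1) * ∏ p ∈ S, (F.totalDegree * (p : ℝ)⁻¹) := by
  have hfact : ∀ p : S, Fact (p : ℕ).Prime := fun p => ⟨hS p p.2⟩
  set q := ∏ p ∈ S, p with hq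
  have hq0 : 0 < q := Finset.prod_pos fun p hp => (hS p hp).pos
  set A := {x ∈ Fintype.piFinset fun _ : Fin (n + 1) => Finset.Ico (-(N : ℤ)) (N + 1) |
        ∀ p ∈ S, (p : ℤ) ∣ MvPolynomial.eval x F} with hA
  set red : (Fin (n + 1) → ℤ) → ∀ p : S, Fin (n + 1) → ZMod p := fun x p i => (x i : ZMod p)
  set T := Fintype.piFinset fun p : S => ({v : Fin (n + 1) → ZMod p |
    MvPolynomial.eval v (MvPolynomial.map (Int.castRingHom _) F) = 0} : Finset _) with hT
  have hmaps : ∀ x ∈ A, red x ∈ T := by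
    intro x hx
    refine Fintype.mem_piFinset.2 fun p => Finset.mem_filter.2 ⟨Finset.mem_univ _, ?_⟩
    have hd := (Finset.mem_filter.1 hx).2 p p.2
    rw [← ZMod.intCast_zmod_eq_zero_iff_dvd] at hd
    rw [← hd]
    have := MvPolynomial.map_eval (Int.castRingHom (ZMod p)) x F
    exact this.symm
  have hfib : ∀ b ∈ T, (#{x ∈ A | red x = b} : ℝ) ≤ (4 * N / q) ^ (n + 1) := by
    intro b _
    rcases ({x ∈ A | red x = b} : Finset _).eq_empty_or_nonempty with h0 | ⟨x₀, hx₀⟩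
    · rw [h0]; simp; positivity
    have hsub : ({x ∈ A | red x = b} : Finset _) ⊆ Fintype.piFinset fun i =>
        {t ∈ Finset.Ico (-(N : ℤ)) (N + 1) | (q : ℤ) ∣ t - x₀ i} := by
      intro x hx
      obtain ⟨hxA, hxb⟩ := Finset.mem_filter.1 hx
      obtain ⟨-, hxb₀⟩ := Finset.mem_filter.1 hx₀
      refine Fintype.mem_piFinset.2 fun i => Finset.mem_filter.2
        ⟨Fintype.mem_piFinset.1 (Finset.mem_filter.1 hxA).1 i, ?_⟩
      rw [hq, Nat.cast_prod]
      refine Finset.prod_dvd_of_coprime (fun p hp r hr hpr => ?_) fun p hp => ?_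
      · exact Nat.isCoprime_iff_coprime.2 ((Nat.coprime_primes (hS p hp) (hS r hr)).2 hpr)
      · have := congrFun (congrFun (hxb.trans hxb₀.symm) ⟨p, hp⟩) i
        rw [← ZMod.intCast_zmod_eq_zero_iff_dvd]
        push_cast
        exact sub_eq_zero.2 this
    calc (#{x ∈ A | red x = b} : ℝ) ≤ #(Fintype.piFinset fun i =>
        {t ∈ Finset.Ico (-(N : ℤ)) (N + 1) | (q : ℤ) ∣ t - x₀ i}) := by
          exact_mod_cast Finset.card_le_card hsub
      _ = ∏ i, (#{t ∈ Finset.Ico (-(N : ℤ)) (N + 1) | (q : ℤ) ∣ t - x₀ i} : ℝ) := by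
          rw [Fintype.card_piFinset]; push_cast; rfl
      _ ≤ ∏ _i : Fin (n + 1), (4 * N / q : ℝ) := Finset.prod_le_prod (fun _ _ => by positivity)
          fun i _ => Int.card_Ico_filter_dvd_sub_le N q hq0 hSN (x₀ i)
      _ = _ := by rw [Finset.prod_const, Finset.card_univ, Fintype.card_fin]
  have hTcard : (#T : ℝ) ≤ ∏ p ∈ S, (F.totalDegree * (p : ℝ) ^ n) := by
    rw [hT, Fintype.card_piFinset, ← Finset.prod_coe_sort S]
    push_cast
    refine Finset.prod_le_prod (fun _ _ => by positivity) fun p _ => ?_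
    exact_mod_cast F.card_zeros_zmod_le hF p
  calc (#A : ℝ) = ∑ b ∈ T, (#{x ∈ A | red x = b} : ℝ) := by
        exact_mod_cast Finset.card_eq_sum_card_fiberwise hmaps
    _ ≤ #T * (4 * N / q : ℝ) ^ (n + 1) := by
        rw [← nsmul_eq_mul]; exact Finset.sum_le_card_nsmul _ _ _ hfib
    _ ≤ (∏ p ∈ S, (F.totalDegree * (p : ℝ) ^ n)) * (4 * N / q : ℝ) ^ (n + 1) := by gcongr
    _ = _ := by
        have hqR : (q : ℝ) ≠ 0 := by exact_mod_cast hq0.ne'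
        have hqS : ∏ p ∈ S, (p : ℝ) = q := by rw [hq, Nat.cast_prod]
        rw [Finset.prod_mul_distrib, Finset.prod_mul_distrib, Finset.prod_pow,
          Finset.prod_inv_distrib, hqS, div_pow]
        field_simp
        ring

/-- A power of a sum is controlled by a power of the first summand and a binomial coefficient. -/
theorem add_natCast_pow_le_choose (z : ℝ) (hz : 1 ≤ z) (w m : ℕ) :
    (z + w) ^ m ≤ (4 * (m + 1)) ^ m * z ^ m + 4 ^ m * m.factorial * (w.choose m : ℝ) := by
  have hz0 : 0 ≤ z := by linarith
  have hm0 : (0 : ℝ) ≤ m := Nat.cast_nonneg m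
  by_cases hcase : (w : ℝ) ≤ 2 * (m + z)
  · have h1 : z + w ≤ 4 * (m + 1) * z := by nlinarith
    have h2 : (z + w) ^ m ≤ (4 * (m + 1) * z) ^ m := by gcongr
    rw [mul_pow] at h2
    have : (0 : ℝ) ≤ 4 ^ m * m.factorial * (w.choose m : ℝ) := by positivity
    linarith
  · push Not at hcase
    have hwm : m ≤ w := by
      have : (m : ℝ) ≤ w := by linarith
      exact_mod_cast this
    have h1 : z + w ≤ 4 * ((w + 1 - m : ℕ) : ℝ) := by
      rw [Nat.cast_sub (by omega)]; push_cast; linarith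
    have h2 : (z + w) ^ m ≤ (4 * ((w + 1 - m : ℕ) : ℝ)) ^ m := by gcongr
    have h3 : (((w + 1 - m : ℕ) : ℝ)) ^ m ≤ m.factorial * (w.choose m : ℝ) := by
      have := w.pow_sub_le_descFactorial m
      rw [Nat.descFactorial_eq_factorial_mul_choose] at this
      exact_mod_cast this
    rw [mul_pow] at h2
    have h4 : (4 : ℝ) ^ m * (((w + 1 - m : ℕ) : ℝ)) ^ m
        ≤ 4 ^ m * (m.factorial * (w.choose m : ℝ)) := by gcongr
    have : (0 : ℝ) ≤ (4 * (m + 1)) ^ m * z ^ m := by positivity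
    linarith

open Finset in
/-- The `m`-th binomial moment of the number of primes `p ∈ P` dividing `F x`, over a box whose
side length is at least the product of any `m` primes of `P`. -/
theorem MvPolynomial.sum_box_choose_card_prime_dvd_le {n : ℕ} (F : MvPolynomial (Fin (n + 1)) ℤ)
    (hF : Finset.gcd F.support F.coeff = 1) (N m : ℕ) (P : Finset ℕ) (hP : ∀ p ∈ P, p.Prime)
    (hPN : ∀ S ∈ P.powersetCard m, ∏ p ∈ S, p ≤ N) :
    ∑ x ∈ Fintype.piFinset fun _ : Fin (n + 1) => Finset.Ico (-(N : ℤ)) (N + 1),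
        ((#{p ∈ P | ((p : ℕ) : ℤ) ∣ MvPolynomial.eval x F}).choose m : ℝ)
      ≤ (4 * N) ^ (n + 1) * (F.totalDegree * ∑ p ∈ P, (p : ℝ)⁻¹) ^ m := by
  set box := Fintype.piFinset fun _ : Fin (n + 1) => Finset.Ico (-(N : ℤ)) (N + 1)
  have hswap : ∑ x ∈ box, (#{p ∈ P | ((p : ℕ) : ℤ) ∣ MvPolynomial.eval x F}).choose m
      = ∑ S ∈ P.powersetCard m, #{x ∈ box | ∀ p ∈ S, (p : ℤ) ∣ MvPolynomial.eval x F} := by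
    refine Eq.trans ?_ (Finset.sum_card_bipartiteAbove_eq_sum_card_bipartiteBelow
      fun (x : Fin (n + 1) → ℤ) (S : Finset ℕ) => ∀ p ∈ S, (p : ℤ) ∣ MvPolynomial.eval x F)
    refine Finset.sum_congr rfl fun x _ => ?_
    rw [← Finset.card_powersetCard]
    congr 1
    ext S
    simp only [Finset.mem_powersetCard, Finset.mem_bipartiteAbove, Finset.subset_iff,
      Finset.mem_filter]
    grind
  calc _ = ∑ S ∈ P.powersetCard m,
        (#{x ∈ box | ∀ p ∈ S, (p : ℤ) ∣ MvPolynomial.eval x F} : ℝ) := by exact_mod_cast hswap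
    _ ≤ ∑ S ∈ P.powersetCard m, (4 * N) ^ (n + 1) * ∏ p ∈ S, (F.totalDegree * (p : ℝ)⁻¹) :=
        Finset.sum_le_sum fun S hS => F.card_box_forall_prime_dvd_le hF N S
          (fun p hp => hP p ((Finset.mem_powersetCard.1 hS).1 hp)) (hPN S hS)
    _ ≤ _ := by
        rw [← Finset.mul_sum, Finset.mul_sum P]
        gcongr
        exact Finset.sum_powersetCard_prod_le_sum_pow P _ (fun _ _ => by positivity) m

/-- (Lemma 3.12 of the paper.) Let `F ∈ ℤ[x_0,…,x_n]` be a nonzero homogeneous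
polynomial with coprime coefficients. Then there is `C > 0` such that for all
`B ≥ 16`, all `y` with `16 ≤ y ≤ B^{1/(10(m+1)(n+1))}` and all `z ≥ 1`:
`∑_x (z + #{p ≤ y prime : p ∣ F(x)})^m ≤ C·B^{n+1}·(z + log log y)^m`,
the sum over primitive `x ∈ ℤ^{n+1}` with `max|x_i| ≤ B` and `F(x) ≠ 0`. -/
theorem moment_bound_small_prime_divisors (n m : ℕ) (hn : 1 ≤ n)
    (F : MvPolynomial (Fin (n + 1)) ℤ) (hF0 : F ≠ 0)
    (hFhom : ∃ D : ℕ, F.IsHomogeneous D)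
    (hFprim : Finset.gcd F.support F.coeff = 1) :
    ∃ C : ℝ, 0 < C ∧ ∀ B y z : ℝ, 16 ≤ B → 16 ≤ y →
      y ≤ B ^ (1 / (10 * ((m : ℝ) + 1) * ((n : ℝ) + 1))) → 1 ≤ z →
      (∑' x : {x : Fin (n + 1) → ℤ //
            Finset.univ.gcd (fun i => (x i).natAbs) = 1 ∧
            (∀ i, |(x i : ℝ)| ≤ B) ∧ MvPolynomial.eval x F ≠ 0},
          (z + (((Finset.range (⌊y⌋₊ + 1)).filter
              (fun p : ℕ => p.Prime ∧ (p : ℤ) ∣ MvPolynomial.eval x.1 F)).card : ℝ)) ^ m)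
        ≤ C * B ^ (n + 1) * (z + Real.log (Real.log y)) ^ m := by
  set d : ℝ := (F.totalDegree : ℝ)
  refine ⟨4 ^ (n + 1) * ((4 * (m + 1)) ^ m + 4 ^ m * m.factorial * (d * 8) ^ m), by positivity,
    fun B y z hB hy hyB hz => ?_⟩
  set N := ⌊B⌋₊ with hN
  set P := (Finset.range (⌊y⌋₊ + 1)).filter Nat.Prime with hP
  set box := Fintype.piFinset fun _ : Fin (n + 1) => Finset.Ico (-(N : ℤ)) (N + 1) with hbox
  set ω : (Fin (n + 1) → ℤ) → ℕ :=
    fun x => (P.filter fun p : ℕ => (p : ℤ) ∣ MvPolynomial.eval x F).card with hω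
  set L := Real.log (Real.log y) with hL
  have hNB : (N : ℝ) ≤ B := Nat.floor_le (by linarith)
  have hN1 : (1 : ℝ) ≤ N := by exact_mod_cast Nat.le_floor (by push_cast; linarith)
  have hL0 : 0 ≤ L := by
    refine Real.log_nonneg ((Real.le_log_iff_exp_le (by linarith)).2 ?_)
    have := Real.exp_one_lt_d9
    linarith
  have hym : y ^ m ≤ B := by
    set e : ℝ := 1 / (10 * ((m : ℝ) + 1) * ((n : ℝ) + 1)) with he
    have hem : e * m ≤ 1 := by
      have hm0 : (0 : ℝ) ≤ m := Nat.cast_nonneg m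
      have hn0 : (0 : ℝ) ≤ n := Nat.cast_nonneg n
      rw [he, one_div_mul_eq_div, div_le_one (by positivity)]
      nlinarith [mul_nonneg hm0 hn0]
    calc y ^ m ≤ (B ^ e) ^ m := by gcongr
      _ = B ^ (e * m) := by rw [Real.rpow_mul (by linarith), Real.rpow_natCast]
      _ ≤ B ^ (1 : ℝ) := Real.rpow_le_rpow_of_exponent_le (by linarith) hem
      _ = B := Real.rpow_one B
  have hPN : ∀ S ∈ P.powersetCard m, ∏ p ∈ S, p ≤ N := by
    intro S hS
    obtain ⟨hSP, hSm⟩ := Finset.mem_powersetCard.1 hS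
    have h1 : ∏ p ∈ S, p ≤ ⌊y⌋₊ ^ m := by
      rw [← hSm]
      refine Finset.prod_le_pow_card _ _ _ fun p hp => ?_
      have := Finset.mem_range.1 (Finset.mem_filter.1 (hSP hp)).1
      omega
    refine h1.trans (Nat.le_floor ?_)
    push_cast
    refine le_trans ?_ hym
    gcongr
    exact Nat.floor_le (by linarith)
  have htsum : (∑' x : {x : Fin (n + 1) → ℤ //
            Finset.univ.gcd (fun i => (x i).natAbs) = 1 ∧
            (∀ i, |(x i : ℝ)| ≤ B) ∧ MvPolynomial.eval x F ≠ 0},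
          (z + (((Finset.range (⌊y⌋₊ + 1)).filter
              (fun p : ℕ => p.Prime ∧ (p : ℤ) ∣ MvPolynomial.eval x.1 F)).card : ℝ)) ^ m)
      ≤ ∑ x ∈ box, (z + ω x) ^ m := by
    simp_rw [← Finset.filter_filter]
    refine (tsum_subtype {x : Fin (n + 1) → ℤ | Finset.univ.gcd (fun i => (x i).natAbs) = 1 ∧
      (∀ i, |(x i : ℝ)| ≤ B) ∧ MvPolynomial.eval x F ≠ 0} fun x => (z + ω x) ^ m).trans_le ?_
    rw [tsum_eq_sum (s := box)]
    · exact Finset.sum_le_sum fun x _ => Set.indicator_le_self' (fun _ _ => by positivity) x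
    · intro x hx
      refine Set.indicator_of_notMem (fun hxs => hx (Fintype.mem_piFinset.2 fun i => ?_)) _
      have h1 : (x i).natAbs ≤ N := Nat.le_floor (by
        rw [Nat.cast_natAbs, Int.cast_abs]; exact hxs.2.1 i)
      rw [Finset.mem_Ico]
      omega
  have hcard : (box.card : ℝ) ≤ (4 * B) ^ (n + 1) := by
    rw [hbox, Fintype.card_piFinset]
    simp only [Int.card_Ico, Finset.prod_const, Finset.card_univ, Fintype.card_fin]
    rw [show ((N : ℤ) + 1 - -(N : ℤ)).toNat = 2 * N + 1 by omega]
    push_cast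
    gcongr
    linarith
  have hmoment : ∑ x ∈ box, ((ω x).choose m : ℝ) ≤ (4 * B) ^ (n + 1) * (d * (8 * (z + L))) ^ m := by
    refine (F.sum_box_choose_card_prime_dvd_le hFprim N m P
      (fun p hp => (Finset.mem_filter.1 hp).2) hPN).trans ?_
    have := sum_inv_primes_le_log_log y (by linarith)
    gcongr
    linarith
  have hzL : z ≤ z + L := by linarith
  calc _ ≤ ∑ x ∈ box, (z + ω x) ^ m := htsum
    _ ≤ ∑ x ∈ box, ((4 * (m + 1)) ^ m * z ^ m + 4 ^ m * m.factorial * ((ω x).choose m : ℝ)) :=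
        Finset.sum_le_sum fun x _ => add_natCast_pow_le_choose z hz (ω x) m
    _ = box.card * ((4 * (m + 1)) ^ m * z ^ m)
        + 4 ^ m * m.factorial * ∑ x ∈ box, ((ω x).choose m : ℝ) := by
        rw [Finset.sum_add_distrib, Finset.sum_const, nsmul_eq_mul, Finset.mul_sum]
    _ ≤ (4 * B) ^ (n + 1) * ((4 * (m + 1)) ^ m * (z + L) ^ m)
        + 4 ^ m * m.factorial * ((4 * B) ^ (n + 1) * (d * (8 * (z + L))) ^ m) := by gcongr
    _ = _ := by simp only [mul_pow]; ring
end

section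
/- Let q_i denote the i-th prime number. Then for all sufficiently large integers j: ∑_{i=1}^{j} ( log q_i + log log q_i ) ≥ j·log j + (3/4)·j·log log j. Equivalently, log( ∏_{i=1}^{j} q_i·log q_i ) ≥ j log j + (3/4) j log log j for all large j. -/
theorem neg_one_le_log_log {x : ℝ} (hx : 2 ≤ x) : -1 ≤ Real.log (Real.log x) := by
  have h2 := Real.log_two_gt_d9
  have hlog : 1 / 2 ≤ Real.log x := by
    linarith [Real.log_le_log (by norm_num) hx]
  have hinv : (Real.log x)⁻¹ ≤ 2 := by
    simpa using inv_anti₀ (by norm_num) hlog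
  linarith [Real.one_sub_inv_le_log_of_pos (by linarith : 0 < Real.log x)]

theorem log_log_sub_one_le_of_le_sq {x y : ℝ} (hx : 1 < x) (h : x ≤ y ^ 2) :
    Real.log (Real.log x) - 1 ≤ Real.log (Real.log y) := by
  have hlx : 0 < Real.log x := Real.log_pos hx
  have hle : Real.log x ≤ 2 * Real.log y := by
    simpa [Real.log_pow] using Real.log_le_log (by linarith) h
  have hll := Real.log_le_log hlx hle
  rw [Real.log_mul (by norm_num) (by linarith)] at hll
  linarith [Real.log_two_lt_d9]

theorem mul_log_sub_self_le_sum_log_succ {n : ℕ} (hn : 0 < n) :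
    (n : ℝ) * Real.log n - n ≤ ∑ i ∈ Finset.range n, Real.log ((i : ℝ) + 1) := by
  have hfac : ∑ i ∈ Finset.range n, Real.log ((i : ℝ) + 1) = Real.log (n.factorial : ℝ) := by
    rw [← Finset.prod_range_add_one_eq_factorial, Nat.cast_prod,
      Real.log_prod fun i _ => by positivity]
    simp
  have hn' : (0 : ℝ) < n := Nat.cast_pos.2 hn
  have h := Real.log_le_log (by positivity) (Real.pow_div_factorial_le_exp (n : ℝ) hn'.le n)
  rw [Real.log_exp, Real.log_div (by positivity) (by positivity), Real.log_pow] at h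
  linarith

theorem sum_log_log_nth_prime_lower_bound {n : ℕ} (hn : 2 ≤ n) :
    ((n : ℝ) - n.sqrt) * (Real.log (Real.log n) - 1) - n.sqrt ≤
      ∑ i ∈ Finset.range n, Real.log (Real.log (Nat.nth Nat.Prime i)) := by
  have hprime (i : ℕ) : (i : ℝ) + 2 ≤ Nat.nth Nat.Prime i := by
    exact_mod_cast Nat.add_two_le_nth_prime i
  rw [← Finset.sum_range_add_sum_Ico _ n.sqrt_le_self]
  have hsmall : -(n.sqrt : ℝ) ≤
      ∑ i ∈ Finset.range n.sqrt, Real.log (Real.log (Nat.nth Nat.Prime i)) := by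
    have := Finset.card_nsmul_le_sum (Finset.range n.sqrt)
      (fun i => Real.log (Real.log (Nat.nth Nat.Prime i))) (-1)
      fun i _ => neg_one_le_log_log (by linarith [hprime i, (i.cast_nonneg : (0 : ℝ) ≤ i)])
    simpa using this
  have hlarge : ((n : ℝ) - n.sqrt) * (Real.log (Real.log n) - 1) ≤
      ∑ i ∈ Finset.Ico n.sqrt n, Real.log (Real.log (Nat.nth Nat.Prime i)) := by
    have := Finset.card_nsmul_le_sum (Finset.Ico n.sqrt n)
      (fun i => Real.log (Real.log (Nat.nth Nat.Prime i))) (Real.log (Real.log n) - 1) ?_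
    · simpa [Nat.cast_sub n.sqrt_le_self] using this
    intro i hi
    have hsq : n ≤ Nat.nth Nat.Prime i ^ 2 := by
      have h₁ := Nat.lt_succ_sqrt n
      have h₂ := Nat.add_two_le_nth_prime i
      have h₃ := (Finset.mem_Ico.1 hi).1
      rw [Nat.succ_eq_add_one] at h₁
      nlinarith
    exact log_log_sub_one_le_of_le_sq (by exact_mod_cast hn) (by exact_mod_cast hsq)
  linarith

/-- (From §4.1.3 of the paper.) Writing `q_i` for the `i`-th prime (so
`Nat.nth Nat.Prime 0 = 2`), for all sufficiently large `j`:
`∑_{i=1}^{j} (log q_i + log log q_i) ≥ j·log j + (3/4)·j·log log j`, i.e.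
`log(∏_{i=1}^{j} q_i·log q_i) ≥ j log j + (3/4) j log log j`. -/
theorem sum_log_nth_prime_lower_bound :
    ∃ J : ℕ, ∀ j : ℕ, J ≤ j →
      (j : ℝ) * Real.log j + 3 / 4 * j * Real.log (Real.log j) ≤
        ∑ i ∈ Finset.range j,
          (Real.log (Nat.nth Nat.Prime i) + Real.log (Real.log (Nat.nth Nat.Prime i))) := by
  have hlim : Filter.Tendsto (fun j : ℕ => Real.log (Real.log j)) Filter.atTop Filter.atTop :=
    Real.tendsto_log_atTop.comp (Real.tendsto_log_atTop.comp tendsto_natCast_atTop_atTop)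
  refine Filter.eventually_atTop.1 ?_
  filter_upwards [hlim.eventually_ge_atTop 12, Filter.eventually_ge_atTop 256] with j hL hj
  have hsqrt : 16 * j.sqrt ≤ j := by
    have h₁ : 16 ≤ j.sqrt := Nat.le_sqrt.2 hj
    nlinarith [j.sqrt_le]
  have hsqrt' : 16 * (j.sqrt : ℝ) ≤ j := by exact_mod_cast hsqrt
  have hlog : ∑ i ∈ Finset.range j, Real.log ((i : ℝ) + 1) ≤
      ∑ i ∈ Finset.range j, Real.log (Nat.nth Nat.Prime i) := by
    refine Finset.sum_le_sum fun i _ => Real.log_le_log (by positivity) ?_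
    exact_mod_cast (Nat.le_succ _).trans (Nat.add_two_le_nth_prime i)
  have hfac := mul_log_sub_self_le_sum_log_succ (by lia : 0 < j)
  have hloglog := sum_log_log_nth_prime_lower_bound (by lia : 2 ≤ j)
  rw [Finset.sum_add_distrib]
  have hj' : (0 : ℝ) ≤ j := j.cast_nonneg
  nlinarith [mul_nonneg (sub_nonneg.2 hsqrt') (by linarith : 0 ≤ Real.log (Real.log j) - 1),
    mul_nonneg hj' (sub_nonneg.2 hL)]
end

section
/- Let q_i denote the i-th prime number. For every real constant c ≥ 1 there exists J such that for all integers j ≥ J: c^j · ∏_{i=1}^{j} 1/( q_i · log q_i ) ≤ 1 / ( j^j · (log j)^{j/2} ). -/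
theorem Nat.succ_lt_nth_prime (n : ℕ) : n + 1 < Nat.nth Nat.Prime n := by
  have := Nat.add_two_le_nth_prime n
  omega

theorem Nat.self_pow_le_exp_mul_factorial (n : ℕ) :
    (n : ℝ) ^ n ≤ Real.exp n * (n.factorial : ℝ) := by
  have h := Real.pow_div_factorial_le_exp (n : ℝ) (Nat.cast_nonneg n) n
  rwa [div_le_iff₀ (by positivity)] at h

theorem Nat.self_pow_le_exp_mul_prod_nth_prime (n : ℕ) :
    (n : ℝ) ^ n ≤ Real.exp n * ∏ i ∈ Finset.range n, (Nat.nth Nat.Prime i : ℝ) := by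
  refine (Nat.self_pow_le_exp_mul_factorial n).trans ?_
  rw [← Finset.prod_range_add_one_eq_factorial, Nat.cast_prod]
  gcongr with i
  exact (Nat.succ_lt_nth_prime i).le

/-- The primes beyond the first quarter have logarithm at least `log n / 2`; the others have
logarithm at least `1 / 2`. -/
theorem Nat.pow_le_prod_log_nth_prime {n : ℕ} (hn : 16 ≤ n) {a : ℝ} (ha : 1 ≤ a)
    (han : a ^ 4 = Real.log n) :
    (a ^ 3 / 2) ^ n ≤ ∏ i ∈ Finset.range n, Real.log (Nat.nth Nat.Prime i) := by
  have hn' : (16 : ℝ) ≤ n := by exact_mod_cast hn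
  have hsmall (i : ℕ) : 1 / 2 ≤ Real.log (Nat.nth Nat.Prime i) := by
    have h2 : (2 : ℝ) ≤ Nat.nth Nat.Prime i := by
      exact_mod_cast (Nat.prime_nth_prime i).two_le
    have := Real.log_le_log two_pos h2
    linarith [Real.log_two_gt_d9]
  have hlarge (i : ℕ) (hi : n / 4 ≤ i) : a ^ 4 / 2 ≤ Real.log (Nat.nth Nat.Prime i) := by
    have hq : (n : ℝ) / 4 ≤ Nat.nth Nat.Prime i := by
      have h : n ≤ 4 * Nat.nth Nat.Prime i := by
        have := Nat.succ_lt_nth_prime i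
        omega
      have h' : (n : ℝ) ≤ 4 * Nat.nth Nat.Prime i := by exact_mod_cast h
      linarith
    rw [han, ← Real.log_sqrt (by positivity)]
    refine Real.log_le_log (by positivity) (le_trans ?_ hq)
    rw [Real.sqrt_le_left (by positivity)]
    nlinarith
  have hk : n / 4 ≤ n := Nat.div_le_self n 4
  rw [← Finset.prod_range_mul_prod_Ico _ hk]
  calc (a ^ 3 / 2) ^ n = (1 / 2) ^ n * a ^ (3 * n) := by
        rw [pow_mul, ← mul_pow]; ring
    _ ≤ (1 / 2) ^ n * a ^ (4 * (n - n / 4)) := by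
        refine mul_le_mul_of_nonneg_left (pow_le_pow_right₀ ha ?_) (by positivity)
        omega
    _ = (1 / 2) ^ (n / 4) * (a ^ 4 / 2) ^ (n - n / 4) := by
        conv_lhs => rw [← Nat.add_sub_cancel' hk, pow_add]
        rw [Nat.add_sub_cancel' hk, pow_mul, mul_assoc, ← mul_pow, one_div_mul_eq_div]
    _ = (∏ _i ∈ Finset.range (n / 4), (1 / 2 : ℝ)) * ∏ _i ∈ Finset.Ico (n / 4) n, a ^ 4 / 2 := by
        simp [div_pow]
    _ ≤ _ := by
        gcongr with i _ i hi
        · exact hsmall i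
        · exact hlarge i (Finset.mem_Ico.mp hi).1

/-- (Final estimate of §4.1.3 of the paper.) Writing `q_i` for the `i`-th prime
(so `Nat.nth Nat.Prime 0 = 2`), for every constant `c ≥ 1` and all sufficiently
large `j`: `c^j · ∏_{i=1}^{j} 1/(q_i·log q_i) ≤ 1/(j^j·(log j)^{j/2})`. -/
theorem tail_bound_prod_nth_primes (c : ℝ) (hc : 1 ≤ c) :
    ∃ J : ℕ, ∀ j : ℕ, J ≤ j →
      c ^ j * ∏ i ∈ Finset.range j,
          1 / ((Nat.nth Nat.Prime i : ℝ) * Real.log (Nat.nth Nat.Prime i)) ≤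
        1 / ((j : ℝ) ^ j * Real.log j ^ ((j : ℝ) / 2)) := by
  have hlim := (Real.tendsto_log_atTop.comp tendsto_natCast_atTop_atTop).eventually_ge_atTop
    ((2 * c * Real.exp 1) ^ 4)
  rw [← Filter.eventually_atTop]
  filter_upwards [hlim, Filter.eventually_ge_atTop 16] with j hj hj16
  have hK : 1 ≤ 2 * c * Real.exp 1 := by nlinarith [Real.add_one_le_exp 1]
  have hlog : 0 < Real.log j := lt_of_lt_of_le (by positivity) hj
  obtain ⟨a, ha, haj⟩ : ∃ a : ℝ, 0 ≤ a ∧ a ^ 4 = Real.log j :=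
    ⟨Real.sqrt (Real.sqrt (Real.log j)), by positivity, by
      rw [show 4 = 2 * 2 from rfl, pow_mul, Real.sq_sqrt (by positivity), Real.sq_sqrt hlog.le]⟩
  have hKa : 2 * c * Real.exp 1 ≤ a := by
    refine le_of_pow_le_pow_left₀ four_ne_zero ha ?_
    rw [haj]
    exact hj
  have ha0 : 0 < a := by linarith
  have hpow : Real.log j ^ ((j : ℝ) / 2) = (a ^ 2) ^ j := by
    rw [← haj, show a ^ 4 = (a ^ 2) ^ (2 : ℝ) by norm_cast; ring,
      ← Real.rpow_mul (by positivity), mul_div_cancel₀ _ two_ne_zero, Real.rpow_natCast]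
  have hq := Nat.self_pow_le_exp_mul_prod_nth_prime j
  have hl := Nat.pow_le_prod_log_nth_prime hj16 (hK.trans hKa) haj
  have hj0 : (0 : ℝ) < j := by exact_mod_cast (by omega : 0 < j)
  have hP : 0 < ∏ i ∈ Finset.range j, (Nat.nth Nat.Prime i : ℝ) :=
    Finset.prod_pos fun i _ ↦ by exact_mod_cast (Nat.prime_nth_prime i).pos
  have hL : 0 < ∏ i ∈ Finset.range j, Real.log (Nat.nth Nat.Prime i) :=
    lt_of_lt_of_le (by positivity) hl
  rw [hpow, Finset.prod_div_distrib, Finset.prod_const_one, Finset.prod_mul_distrib, mul_one_div,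
    div_le_div_iff₀ (by positivity) (by positivity), one_mul]
  calc c ^ j * ((j : ℝ) ^ j * (a ^ 2) ^ j)
      ≤ c ^ j * ((Real.exp j * ∏ i ∈ Finset.range j, (Nat.nth Nat.Prime i : ℝ)) * (a ^ 2) ^ j) := by
        gcongr
    _ = (c * Real.exp 1 * a ^ 2) ^ j * ∏ i ∈ Finset.range j, (Nat.nth Nat.Prime i : ℝ) := by
        rw [← Real.exp_one_pow]
        ring
    _ ≤ (a ^ 3 / 2) ^ j * ∏ i ∈ Finset.range j, (Nat.nth Nat.Prime i : ℝ) := by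
        gcongr
        nlinarith [mul_le_mul_of_nonneg_right hKa (sq_nonneg a)]
    _ ≤ (∏ i ∈ Finset.range j, (Nat.nth Nat.Prime i : ℝ)) *
          ∏ i ∈ Finset.range j, Real.log (Nat.nth Nat.Prime i) := by
        rw [mul_comm]
        gcongr
end

section
/- (Erdős–Kac theorem.) Let ω(m) denote the number of distinct prime divisors of m. Then for every real number z: lim_{x → ∞} (1/x) · #{ m ∈ ℕ : 3 ≤ m ≤ x, ω(m) − log log m ≤ z·√(log log m) } = (1/√(2π)) ∫_{−∞}^{z} e^{−t²/2} dt. Equivalently, for every interval 𝒥 ⊆ ℝ, the proportion of m ≤ x with (ω(m) − log log m)/√(log log m) ∈ 𝒥 tends to the standard Gaussian measure of 𝒥. -/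
open scoped Classical

namespace ErdosKac

open Finset

lemma log_factorial_eq_sum_primesLE (n : ℕ) :
    Real.log (n.factorial) =
      ∑ p ∈ Nat.primesLE n, ((n.factorial).factorization p : ℝ) * Real.log p := by
  rw [Real.log_nat_eq_sum_factorization]
  refine Finsupp.sum_of_support_subset _ (fun p hp ↦ ?_) _ (by simp)
  rw [Nat.support_factorization, Nat.mem_primeFactors] at hp
  exact Nat.mem_primesLE.2 ⟨(hp.1.dvd_factorial).1 hp.2.1, hp.1⟩

lemma div_le_factorization_factorial {n p : ℕ} (hp : p.Prime) :
    n / p ≤ (n.factorial).factorization p := by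
  rw [← hp.pow_dvd_iff_le_factorization n.factorial_ne_zero]
  calc p ^ (n / p) ∣ p ^ (n / p) * (n / p).factorial := dvd_mul_right _ _
    _ ∣ (p * (n / p)).factorial := by
      generalize n / p = k
      induction k with
      | zero => simp
      | succ k ih =>
        rw [mul_add_one, pow_succ, Nat.factorial_succ k]
        have h : p * k + p = (p * k + (p - 1)) + 1 := by have := hp.pos; omega
        rw [h, Nat.factorial_succ, ← h,
          show p ^ k * p * ((k + 1) * k.factorial) = (p * k + p) * (p ^ k * k.factorial) by ring]
        exact mul_dvd_mul_left _ (ih.trans (Nat.factorial_dvd_factorial (by omega)))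
    _ ∣ n.factorial := Nat.factorial_dvd_factorial (Nat.mul_div_le n p)

lemma log_factorial_le (n : ℕ) : Real.log n.factorial ≤ n * Real.log n := by
  rw [← Real.log_pow]
  exact Real.log_le_log (by positivity) (by exact_mod_cast n.factorial_le_pow)

lemma le_log_factorial {n : ℕ} (hn : n ≠ 0) :
    n * Real.log n - n ≤ Real.log n.factorial := by
  have h := Real.pow_div_factorial_le_exp (x := n) (by positivity) n
  have h2 := Real.log_le_log (by positivity) h
  rw [Real.log_exp, Real.log_div (by positivity) (by positivity), Real.log_pow] at h2
  linarith

lemma log_div_mul_pred_le {p : ℕ} (hp : 2 ≤ p) :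
    Real.log p / (p * (p - 1)) ≤ 4 * (1 / (p : ℝ) ^ (3 / 2 : ℝ)) := by
  have hp' : (2 : ℝ) ≤ p := by exact_mod_cast hp
  have h1 : Real.log p ≤ 2 * (p : ℝ) ^ (1 / 2 : ℝ) := by
    have := Real.log_le_rpow_div (x := p) (by positivity) (show (0 : ℝ) < 1 / 2 by norm_num)
    linarith
  have h2 : (p : ℝ) ^ (3 / 2 : ℝ) * (p : ℝ) ^ (1 / 2 : ℝ) = p * p := by
    rw [← Real.rpow_add (by positivity)]; norm_num; ring
  have h3 : 0 < (p : ℝ) ^ (3 / 2 : ℝ) := by positivity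
  rw [mul_one_div, div_le_div_iff₀ (by nlinarith) h3]
  calc _ ≤ 2 * (p : ℝ) ^ (1 / 2 : ℝ) * (p : ℝ) ^ (3 / 2 : ℝ) := by gcongr
    _ = 2 * (p * p) := by rw [← h2]; ring
    _ ≤ _ := by nlinarith

/-- Mertens' first theorem. -/
lemma exists_abs_sum_log_div_sub_log_le :
    ∃ C : ℝ, ∀ n : ℕ, n ≠ 0 →
      |∑ p ∈ Nat.primesLE n, Real.log p / p - Real.log n| ≤ C := by
  have hs : Summable fun m : ℕ ↦ 4 * (1 / (m : ℝ) ^ (3 / 2 : ℝ)) :=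
    (Real.summable_one_div_nat_rpow.2 (by norm_num)).mul_left 4
  set K := ∑' m : ℕ, 4 * (1 / (m : ℝ) ^ (3 / 2 : ℝ))
  have hK : 0 ≤ K := tsum_nonneg fun m ↦ by positivity
  have h4 : 0 ≤ Real.log 4 := Real.log_nonneg (by norm_num)
  refine ⟨Real.log 4 + K + 1, fun n hn ↦ ?_⟩
  have hn' : (0 : ℝ) < n := by positivity
  have key := log_factorial_eq_sum_primesLE n
  have hup : (n : ℝ) * ∑ p ∈ Nat.primesLE n, Real.log p / p ≤
      Real.log n.factorial + Real.log 4 * n := by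
    have hθ := Chebyshev.theta_le_log4_mul_x hn'.le
    rw [Chebyshev.theta_eq_sum_primesLE_log] at hθ
    rw [key]
    refine le_trans ?_ (add_le_add_right hθ _)
    rw [mul_sum, ← sum_add_distrib]
    refine sum_le_sum fun p hp ↦ ?_
    have hp := Nat.mem_primesLE.1 hp
    have hlog : 0 ≤ Real.log p := Real.log_natCast_nonneg p
    have h1 : (n : ℝ) / p ≤ (n.factorial).factorization p + 1 := by
      calc (n : ℝ) / p ≤ ((n / p : ℕ) : ℝ) + 1 := by
            rw [← Nat.floor_div_eq_div (K := ℝ)]; exact (Nat.lt_floor_add_one _).le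
        _ ≤ _ := by gcongr; exact div_le_factorization_factorial hp.2
    calc _ = (n : ℝ) / p * Real.log p := by ring
      _ ≤ _ := by nlinarith
  have hlow : Real.log n.factorial ≤
      n * (∑ p ∈ Nat.primesLE n, Real.log p / p + K) := by
    have hKs : ∑ p ∈ Nat.primesLE n, Real.log p / (p * (p - 1)) ≤ K :=
      (sum_le_sum fun p hp ↦ log_div_mul_pred_le (Nat.mem_primesLE.1 hp).2.two_le).trans
        (hs.sum_le_tsum _ fun m _ ↦ by positivity)
    refine le_trans ?_ (mul_le_mul_of_nonneg_left (add_le_add_right hKs _) hn'.le)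
    rw [key, ← sum_add_distrib, mul_sum]
    refine sum_le_sum fun p hp ↦ ?_
    have hp := (Nat.mem_primesLE.1 hp).2
    have hp2 : (2 : ℝ) ≤ p := by exact_mod_cast hp.two_le
    have h1 : ((n.factorial).factorization p : ℝ) ≤ n / (p - 1) := by
      refine (Nat.cast_le.2 (Nat.factorization_factorial_le_div_pred hp n)).trans ?_
      refine Nat.cast_div_le.trans ?_
      rw [Nat.cast_pred hp.pos]
    have hlog : 0 ≤ Real.log p := Real.log_natCast_nonneg p
    refine (mul_le_mul_of_nonneg_right h1 hlog).trans (le_of_eq ?_)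
    have : (p : ℝ) - 1 ≠ 0 := by linarith
    field_simp
    ring
  have h1 := log_factorial_le n
  have h2 := le_log_factorial hn
  rw [abs_le]
  constructor
  · have : (n : ℝ) * (Real.log n - 1) ≤ n * (∑ p ∈ Nat.primesLE n, Real.log p / p + K) := by
      linarith
    have := le_of_mul_le_mul_left this hn'
    linarith
  · have : (n : ℝ) * ∑ p ∈ Nat.primesLE n, Real.log p / p ≤ n * (Real.log n + Real.log 4) := by
      linarith
    have := le_of_mul_le_mul_left this hn'
    linarith

/-- Mertens' second theorem. -/
lemma exists_abs_sum_primes_one_div_sub_log_log_le :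
    ∃ C : ℝ, ∀ n : ℕ, 2 ≤ n →
      |∑ p ∈ Nat.primesLE n, (1 / p : ℝ) - Real.log (Real.log n)| ≤ C := by
  obtain ⟨C, hC⟩ := exists_abs_sum_log_div_sub_log_le
  have hC0 : 0 ≤ C := (abs_nonneg _).trans (hC 1 one_ne_zero)
  set A : ℕ → ℝ := fun n ↦ ∑ p ∈ Nat.primesLE n, Real.log p / p
  set S : ℕ → ℝ := fun n ↦ ∑ p ∈ Nat.primesLE n, (1 / p : ℝ)
  set E : ℕ → ℝ := fun n ↦ S n - Real.log (Real.log n) - (A n - Real.log n) / Real.log n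
  have hlog2 : 0 < Real.log 2 := Real.log_pos (by norm_num)
  have hstep (n : ℕ) (hn : 2 ≤ n) :
      |E (n + 1) - E n| ≤ (C + 1) * (1 / Real.log n - 1 / Real.log (n + 1 : ℕ)) := by
    have hn' : (2 : ℝ) ≤ n := by exact_mod_cast hn
    set a := Real.log n
    set b := Real.log (n + 1 : ℕ)
    have ha : 0 < a := Real.log_pos (by linarith)
    have hab : a < b := Real.log_lt_log (by linarith) (by push_cast; linarith)
    have hb : 0 < b := ha.trans hab
    have hba : b - a ≤ 1 := by
      rw [← Real.log_div (by positivity) (by positivity)]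
      refine (Real.log_le_sub_one_of_pos (by positivity)).trans ?_
      rw [sub_le_iff_le_add, div_le_iff₀ (by positivity)]
      push_cast; linarith
    have hSA : S (n + 1) - S n = (A (n + 1) - A n) / b := by
      simp only [S, A]
      rw [Nat.primesLE_succ]
      split_ifs with h
      · rw [sum_insert (Nat.notMem_primesLE n), sum_insert (Nat.notMem_primesLE n)]
        simp only [add_sub_cancel_right]
        change _ = b / _ / b
        field_simp
      · simp
    have hE : E (n + 1) - E n =
        ((b - a) / b - Real.log (b / a)) + (A n - a) * (1 / a - 1 / b) := by
      have : E (n + 1) - E n = (S (n + 1) - S n) - (Real.log b - Real.log a) -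
        ((A (n + 1) - b) / b - (A n - a) / a) := by simp only [E, a, b]; ring
      rw [this, hSA, Real.log_div hb.ne' ha.ne']
      field_simp
      ring
    have hd : 0 ≤ 1 / a - 1 / b := by
      rw [sub_nonneg]; exact one_div_le_one_div_of_le ha hab.le
    have h1 : |(b - a) / b - Real.log (b / a)| ≤ 1 / a - 1 / b := by
      have hl := Real.log_le_sub_one_of_pos (div_pos hb ha)
      have hu := Real.one_sub_inv_le_log_of_pos (div_pos hb ha)
      have e1 : (b - a) / b = 1 - (b / a)⁻¹ := by field_simp
      have e2 : b / a - 1 - (b - a) / b = (b - a) * (1 / a - 1 / b) := by field_simp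
      rw [abs_le]
      constructor <;> nlinarith
    rw [hE, add_mul, add_comm (C * _)]
    refine (abs_add_le _ _).trans (add_le_add (by linarith) ?_)
    rw [abs_mul, abs_of_nonneg hd]
    exact mul_le_mul_of_nonneg_right (hC n (by omega)) hd
  have hind (n : ℕ) (hn : 2 ≤ n) :
      |E n| ≤ |E 2| + (C + 1) * (1 / Real.log 2 - 1 / Real.log n) := by
    induction n, hn using Nat.le_induction with
    | base => simp
    | succ n hn ih =>
      have h1 := hstep n hn
      have h2 := abs_sub_abs_le_abs_sub (E (n + 1)) (E n)
      linarith
  refine ⟨|E 2| + (C + 1) * (1 / Real.log 2) + C / Real.log 2, fun n hn ↦ ?_⟩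
  have hln : Real.log 2 ≤ Real.log n :=
    Real.log_le_log (by norm_num) (by exact_mod_cast hn)
  have hln0 := hlog2.trans_le hln
  have h1 := hind n hn
  have h2 : |(A n - Real.log n) / Real.log n| ≤ C / Real.log 2 := by
    rw [abs_div, abs_of_pos hln0]
    exact div_le_div₀ hC0 (hC n (by omega)) hlog2 hln
  have h3 : (C + 1) * (1 / Real.log 2 - 1 / Real.log n) ≤ (C + 1) * (1 / Real.log 2) := by
    have : 0 < 1 / Real.log n := by positivity
    gcongr; linarith
  have h4 : S n - Real.log (Real.log n) = E n + (A n - Real.log n) / Real.log n := by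
    simp only [E]; ring
  change |S n - Real.log (Real.log n)| ≤ _
  rw [h4]
  exact (abs_add_le _ _).trans (by linarith)

lemma card_filter_dvd_Icc (n d : ℕ) : #{m ∈ Icc 1 n | d ∣ m} = n / d :=
  Nat.Ioc_filter_dvd_card_eq_div n d

lemma prod_one_add_ite_dvd {P : Finset ℕ} (hP : ∀ p ∈ P, p.Prime) (z : ℂ) (m : ℕ) :
    ∏ p ∈ P, (1 + if p ∣ m then z else 0) =
      ∑ S ∈ P.powerset, if ∏ p ∈ S, p ∣ m then z ^ #S else 0 := by
  rw [prod_one_add]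
  refine sum_congr rfl fun S hS ↦ ?_
  rw [prod_ite_zero, prod_const]
  refine if_congr ⟨fun h ↦ ?_, fun h p hp ↦ (dvd_prod_of_mem _ hp).trans h⟩ rfl rfl
  exact prod_primes_dvd m (fun p hp ↦ (hP p (mem_powerset.1 hS hp)).prime) h

lemma abs_div_div_sub_le_one_div {n d : ℕ} (hn : n ≠ 0) (hd : d ≠ 0) :
    |((n / d : ℕ) : ℝ) / n - 1 / d| ≤ 1 / n ∧ |((n / d : ℕ) : ℝ) / n - 1 / d| ≤ 1 / d := by
  have hn' : (0 : ℝ) < n := by positivity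
  have hd' : (0 : ℝ) < d := by positivity
  have h1 : ((n / d : ℕ) : ℝ) / n ≤ 1 / d := by
    rw [div_le_div_iff₀ hn' hd', one_mul]
    exact_mod_cast Nat.div_mul_le_self n d
  have h2 : 1 / (d : ℝ) ≤ ((n / d : ℕ) : ℝ) / n + 1 / n := by
    rw [← add_div, div_le_div_iff₀ hd' hn', one_mul]
    exact_mod_cast (Nat.lt_mul_of_div_lt (Nat.lt_succ_self (n / d)) (by omega)).le
  have h3 : 0 ≤ ((n / d : ℕ) : ℝ) / n := by positivity
  rw [abs_of_nonpos (by linarith)]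
  constructor <;> linarith

/-- Averages over `[1, n]` of the multiplicative function `m ↦ (1 + z) ^ #{p ∈ P | p ∣ m}` are close
to the Euler product given by the independent model. -/
lemma norm_avg_sub_prod_le {P : Finset ℕ} (hP : ∀ p ∈ P, p.Prime) {y : ℕ} (hy0 : 1 ≤ y)
    (hy : ∀ p ∈ P, p ≤ y) {n : ℕ} (hn : n ≠ 0) (k : ℕ) (z : ℂ) :
    ‖(∑ m ∈ Icc 1 n, ∏ p ∈ P, (1 + if p ∣ m then z else 0)) / n - ∏ p ∈ P, (1 + z / p)‖ ≤
      ((y : ℝ) ^ k / n + (1 / 2) ^ k) * Real.exp (2 * ‖z‖ * ∑ p ∈ P, (1 / p : ℝ)) := by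
  have hn' : (0 : ℝ) < n := by positivity
  have e1 : (∑ m ∈ Icc 1 n, ∏ p ∈ P, (1 + if p ∣ m then z else 0)) / n =
      ∑ S ∈ P.powerset, z ^ #S * (((n / ∏ p ∈ S, p : ℕ) : ℝ) / n : ℝ) := by
    simp_rw [prod_one_add_ite_dvd hP]
    rw [sum_comm, sum_div]
    refine sum_congr rfl fun S _ ↦ ?_
    rw [← sum_filter, sum_const, card_filter_dvd_Icc, nsmul_eq_mul]
    push_cast
    ring
  have e2 : ∏ p ∈ P, (1 + z / p) =
      ∑ S ∈ P.powerset, z ^ #S * ((1 / (∏ p ∈ S, p : ℕ) : ℝ) : ℂ) := by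
    rw [prod_one_add]
    refine sum_congr rfl fun S _ ↦ ?_
    rw [prod_div_distrib, prod_const]
    push_cast
    ring
  rw [e1, e2, ← sum_sub_distrib]
  have hbound : ∀ S ∈ P.powerset,
      ‖z ^ #S * (((n / ∏ p ∈ S, p : ℕ) : ℝ) / n : ℝ) -
        z ^ #S * ((1 / (∏ p ∈ S, p : ℕ) : ℝ) : ℂ)‖ ≤
      ((y : ℝ) ^ k / n + (1 / 2) ^ k) * ∏ p ∈ S, (2 * ‖z‖ * (1 / p : ℝ)) := by
    intro S hS
    have hS := mem_powerset.1 hS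
    have hd0 : ∏ p ∈ S, p ≠ 0 := prod_ne_zero_iff.2 fun p hp ↦ (hP p (hS hp)).ne_zero
    have hdle : ∏ p ∈ S, p ≤ y ^ #S := prod_le_pow_card _ _ _ fun p hp ↦ hy p (hS hp)
    have hprod : ∏ p ∈ S, (2 * ‖z‖ * (1 / p : ℝ)) =
        2 ^ #S * (‖z‖ ^ #S * (1 / (∏ p ∈ S, p : ℕ))) := by
      rw [prod_mul_distrib, prod_const, mul_pow, prod_div_distrib]
      push_cast
      simp [mul_assoc]
    rw [hprod, ← mul_sub, ← Complex.ofReal_sub, norm_mul, norm_pow, Complex.norm_real,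
      Real.norm_eq_abs]
    set d := ∏ p ∈ S, p
    have hd' : (0 : ℝ) < d := by positivity
    obtain ⟨h1, h2⟩ := abs_div_div_sub_le_one_div hn hd0
    have hz : 0 ≤ ‖z‖ ^ #S := by positivity
    have hy' : (1 : ℝ) ≤ y := by exact_mod_cast hy0
    rcases le_total #S k with hk | hk
    · have hdk : (d : ℝ) ≤ y ^ k := by
        calc (d : ℝ) ≤ y ^ #S := by exact_mod_cast hdle
          _ ≤ y ^ k := pow_le_pow_right₀ hy' hk
      calc _ ≤ ‖z‖ ^ #S * (1 / n) := by gcongr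
        _ = (d : ℝ) / n * (1 * (‖z‖ ^ #S * (1 / d))) := by field_simp
        _ ≤ ((y : ℝ) ^ k / n + (1 / 2) ^ k) * (2 ^ #S * (‖z‖ ^ #S * (1 / d))) := by
          gcongr
          · exact (div_le_div_of_nonneg_right hdk hn'.le).trans
              (le_add_of_nonneg_right (by positivity))
          · exact one_le_pow₀ (by norm_num)
    · calc _ ≤ ‖z‖ ^ #S * (1 / d) := by gcongr
        _ = (1 / 2) ^ k * (2 ^ k * (‖z‖ ^ #S * (1 / d))) := by
          rw [← mul_assoc, ← mul_pow]; norm_num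
        _ ≤ ((y : ℝ) ^ k / n + (1 / 2) ^ k) * (2 ^ #S * (‖z‖ ^ #S * (1 / d))) := by
          gcongr
          · exact le_add_of_nonneg_left (by positivity)
          · norm_num
  refine (norm_sum_le _ _).trans ((sum_le_sum hbound).trans ?_)
  rw [← mul_sum, ← prod_one_add, mul_sum, Real.exp_sum]
  gcongr with p hp
  rw [add_comm]
  exact Real.add_one_le_exp _

lemma norm_prod_sub_prod_le {ι : Type*} (s : Finset ι) {f g : ι → ℂ}
    (hf : ∀ i ∈ s, ‖f i‖ ≤ 1) (hg : ∀ i ∈ s, ‖g i‖ ≤ 1) :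
    ‖∏ i ∈ s, f i - ∏ i ∈ s, g i‖ ≤ ∑ i ∈ s, ‖f i - g i‖ := by
  induction s using Finset.induction_on with
  | empty => simp
  | insert a s ha ih =>
    rw [prod_insert ha, prod_insert ha, sum_insert ha]
    have hg' : ‖∏ i ∈ s, g i‖ ≤ 1 := by
      rw [norm_prod]
      exact prod_le_one (fun _ _ ↦ norm_nonneg _) fun i hi ↦ hg i (mem_insert_of_mem hi)
    have ih := ih (fun i hi ↦ hf i (mem_insert_of_mem hi)) fun i hi ↦ hg i (mem_insert_of_mem hi)
    have e : f a * ∏ i ∈ s, f i - g a * ∏ i ∈ s, g i =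
        (f a - g a) * ∏ i ∈ s, g i + f a * (∏ i ∈ s, f i - ∏ i ∈ s, g i) := by ring
    rw [e]
    refine (norm_add_le _ _).trans ?_
    rw [norm_mul, norm_mul]
    have := hf a (mem_insert_self a s)
    gcongr
    · exact mul_le_of_le_one_right (norm_nonneg _) hg'
    · exact (mul_le_of_le_one_left (norm_nonneg _) this).trans ih

lemma norm_prod_one_add_sub_exp_le {P : Finset ℕ} (hP : ∀ p ∈ P, 1 ≤ p) {θ : ℝ} (hθ : |θ| ≤ 1) :
    ‖∏ p ∈ P, (1 + (Complex.exp (Complex.I * θ) - 1) / p) -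
        Complex.exp ((Complex.exp (Complex.I * θ) - 1) * (∑ p ∈ P, (1 / p : ℝ) : ℝ))‖ ≤
      θ ^ 2 * ∑' m : ℕ, 1 / (m : ℝ) ^ 2 := by
  set z := Complex.exp (Complex.I * θ) - 1 with hz
  have hzθ : ‖z‖ ≤ |θ| := Real.norm_exp_I_mul_ofReal_sub_one_le
  have hexp : Complex.exp (z * (∑ p ∈ P, (1 / p : ℝ) : ℝ)) = ∏ p ∈ P, Complex.exp (z / p) := by
    rw [← Complex.exp_sum]
    push_cast
    simp_rw [mul_sum, mul_one_div]
  have hunit : ‖Complex.exp (Complex.I * θ)‖ = 1 := by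
    rw [mul_comm]; exact Complex.norm_exp_ofReal_mul_I θ
  rw [hexp]
  refine (norm_prod_sub_prod_le P (fun p hp ↦ ?_) fun p hp ↦ ?_).trans ?_
  · have hp1 : (1 : ℝ) ≤ p := by exact_mod_cast hP p hp
    have e : 1 + z / p = ((1 - 1 / p : ℝ) : ℂ) + ((1 / p : ℝ) : ℂ) * Complex.exp (Complex.I * θ) := by
      rw [hz]; push_cast; ring
    have h1 : 1 / (p : ℝ) ≤ 1 := by rw [div_le_one (by linarith)]; exact hp1
    have h2 : 0 ≤ 1 / (p : ℝ) := by positivity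
    rw [e]
    refine (norm_add_le _ _).trans ?_
    rw [norm_mul, hunit, Complex.norm_real, Complex.norm_real, Real.norm_of_nonneg h2,
      Real.norm_of_nonneg (by linarith)]
    linarith
  · rw [Complex.norm_exp, Real.exp_le_one_iff, Complex.div_natCast_re]
    refine div_nonpos_of_nonpos_of_nonneg ?_ (by positivity)
    have := (Complex.re_le_norm (Complex.exp (Complex.I * θ))).trans hunit.le
    simp only [hz, Complex.sub_re, Complex.one_re]
    linarith
  · have hsum : Summable fun m : ℕ ↦ 1 / (m : ℝ) ^ 2 :=
      Real.summable_one_div_nat_pow.2 (by norm_num)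
    refine le_trans ?_ (mul_le_mul_of_nonneg_left
      (hsum.sum_le_tsum P fun m _ ↦ by positivity) (sq_nonneg θ))
    rw [mul_sum]
    refine sum_le_sum fun p hp ↦ ?_
    have hp1 : (1 : ℝ) ≤ p := by exact_mod_cast hP p hp
    have hle : ‖z / p‖ ≤ |θ| / p := by
      rw [norm_div, Complex.norm_natCast]; gcongr
    have h1 : ‖z / p‖ ≤ 1 := hle.trans ((div_le_one (by linarith)).2 (hθ.trans hp1))
    have h2 := Complex.norm_exp_sub_one_sub_id_le h1
    rw [norm_sub_rev, ← sub_sub]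
    refine h2.trans ((pow_le_pow_left₀ (norm_nonneg _) hle 2).trans (le_of_eq ?_))
    rw [div_pow, sq_abs]
    ring

open Filter Topology

lemma tendsto_log_log_natCast :
    Tendsto (fun n : ℕ ↦ Real.log (Real.log n)) atTop atTop :=
  Real.tendsto_log_atTop.comp (Real.tendsto_log_atTop.comp tendsto_natCast_atTop_atTop)

/-- There is a truncation point `y n ≤ n`, so small that products of `log log n` primes up to `y n`
are at most `√n`, and so large that few primes lie between `y n` and `n`. -/
lemma exists_truncation :
    ∃ y : ℕ → ℕ,
      (∀ᶠ n : ℕ in atTop, 1 ≤ y n ∧ y n ≤ n ∧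
        (y n : ℝ) ^ ⌊Real.log (Real.log n)⌋₊ / n ≤ Real.exp (-Real.log (Real.log n) / 2)) ∧
      Tendsto (fun n : ℕ ↦ (∑ p ∈ Nat.primesLE (y n), (1 / p : ℝ) - Real.log (Real.log n)) /
        √(Real.log (Real.log n))) atTop (𝓝 0) ∧
      Tendsto (fun n : ℕ ↦ (∑ p ∈ Nat.primesLE n, (1 / p : ℝ) -
        ∑ p ∈ Nat.primesLE (y n), (1 / p : ℝ)) / √(Real.log (Real.log n))) atTop (𝓝 0) := by
  obtain ⟨C, hC⟩ := exists_abs_sum_primes_one_div_sub_log_log_le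
  have hC0 : 0 ≤ C := (abs_nonneg _).trans (hC 2 le_rfl)
  set s : ℕ → ℝ := fun n ↦ Real.log (Real.log n)
  have hs : Tendsto s atTop atTop := tendsto_log_log_natCast
  set u : ℕ → ℝ := fun n ↦ Real.exp (Real.log n / (2 * (⌊s n⌋₊ + 1)))
  have hev : ∀ᶠ n : ℕ in atTop, 2 ≤ n ∧ 1 < Real.log n ∧ 8 ≤ s n := by
    refine (eventually_ge_atTop 2).and (Eventually.and ?_ (hs.eventually_ge_atTop 8))
    exact (Real.tendsto_log_atTop.comp tendsto_natCast_atTop_atTop).eventually_gt_atTop 1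
  have hmain : ∀ᶠ n : ℕ in atTop, 2 ≤ n ∧ 2 ≤ ⌊u n⌋₊ ∧ ⌊u n⌋₊ ≤ n ∧
      (⌊u n⌋₊ : ℝ) ^ ⌊s n⌋₊ / n ≤ Real.exp (-s n / 2) ∧
      |Real.log (Real.log ⌊u n⌋₊) - s n| ≤ Real.log (8 * s n) := by
    filter_upwards [hev] with n ⟨hn2, hlog1, hs8⟩
    have hn0 : (0 : ℝ) < n := by positivity
    have hlog0 : 0 < Real.log n := by linarith
    have hexps : Real.exp (s n) = Real.log n := Real.exp_log hlog0
    set k := ⌊s n⌋₊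
    have hk : (k : ℝ) ≤ s n := Nat.floor_le (by linarith)
    have hK : 2 * ((k : ℝ) + 1) ≤ 4 * s n := by linarith
    have hK0 : 0 < 2 * ((k : ℝ) + 1) := by positivity
    have hlogu : 1 ≤ Real.log n / (2 * (k + 1)) := by
      rw [le_div_iff₀ hK0, ← hexps]
      nlinarith [Real.quadratic_le_exp_of_nonneg (show 0 ≤ s n by linarith)]
    have hu0 : 0 < u n := Real.exp_pos _
    have hu2 : 2 ≤ u n := by
      have := Real.add_one_le_exp (Real.log n / (2 * (k + 1)))
      change 2 ≤ Real.exp (Real.log n / (2 * (k + 1)))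
      linarith
    have hun : u n ≤ n := by
      conv_rhs => rw [← Real.exp_log hn0]
      refine Real.exp_le_exp.2 (div_le_self hlog0.le ?_)
      have : (0 : ℝ) ≤ k := by positivity
      linarith
    have hfl : (⌊u n⌋₊ : ℝ) ≤ u n := Nat.floor_le hu0.le
    have hfl' : u n < ⌊u n⌋₊ + 1 := Nat.lt_floor_add_one _
    have hy2 : 2 ≤ ⌊u n⌋₊ := Nat.le_floor (by exact_mod_cast hu2)
    have hy2' : (2 : ℝ) ≤ ⌊u n⌋₊ := by exact_mod_cast hy2
    have hyn : ⌊u n⌋₊ ≤ n := by exact_mod_cast hfl.trans hun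
    refine ⟨hn2, hy2, hyn, ?_, ?_⟩
    · have h1 : (⌊u n⌋₊ : ℝ) ^ k ≤ Real.exp (Real.log n / 2) := by
        refine (pow_le_pow_left₀ (by positivity) hfl k).trans ?_
        rw [← Real.exp_nat_mul, Real.exp_le_exp, mul_div_assoc', div_le_div_iff₀ hK0 two_pos]
        nlinarith
      have h2 : s n ≤ Real.log n := Real.log_le_self hlog0.le
      rw [div_le_iff₀ hn0]
      calc _ ≤ Real.exp (Real.log n / 2) := h1
        _ ≤ Real.exp (-s n / 2 + Real.log n) := Real.exp_le_exp.2 (by linarith)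
        _ = Real.exp (-s n / 2) * n := by rw [Real.exp_add, Real.exp_log hn0]
    · have hlogy0 : 0 < Real.log ⌊u n⌋₊ := Real.log_pos (by linarith)
      have hle : Real.log (Real.log ⌊u n⌋₊) ≤ s n :=
        Real.log_le_log hlogy0 (Real.log_le_log (by linarith) (by exact_mod_cast hyn))
      have h1 : Real.log n / (2 * (k + 1)) ≤ 2 * Real.log ⌊u n⌋₊ := by
        rw [← Real.log_exp (Real.log n / (2 * (k + 1)))]
        change Real.log (u n) ≤ _
        have h2 : u n ≤ (⌊u n⌋₊ : ℝ) ^ 2 := by nlinarith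
        refine (Real.log_le_log hu0 h2).trans_eq ?_
        rw [Real.log_pow]; norm_num
      have h3 : Real.log n / (8 * s n) ≤ Real.log ⌊u n⌋₊ := by
        have h4 : Real.log n / (4 * s n) ≤ Real.log n / (2 * (k + 1)) := by gcongr
        have h5 : Real.log n / (8 * s n) = Real.log n / (4 * s n) / 2 := by
          field_simp; norm_num
        rw [h5]; linarith
      have h6 : s n - Real.log (8 * s n) ≤ Real.log (Real.log ⌊u n⌋₊) := by
        rw [← Real.log_div hlog0.ne' (by positivity)]
        exact Real.log_le_log (by positivity) h3
      have h7 : 0 ≤ Real.log (8 * s n) := Real.log_nonneg (by linarith)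
      rw [abs_le]
      constructor <;> linarith
  have hlim : Tendsto (fun n ↦ (2 * C + Real.log (8 * s n)) / √(s n)) atTop (𝓝 0) := by
    have h1 : Tendsto (fun x : ℝ ↦ (2 * C + Real.log 8) / √x + Real.log x / √x) atTop (𝓝 0) := by
      have h2 := (isLittleO_log_rpow_atTop (show (0 : ℝ) < 1 / 2 by norm_num)).tendsto_div_nhds_zero
      simp_rw [← Real.sqrt_eq_rpow] at h2
      simpa using (tendsto_const_nhds.div_atTop Real.tendsto_sqrt_atTop).add h2
    refine (h1.comp hs).congr' ?_
    filter_upwards [hs.eventually_gt_atTop 0] with n hn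
    simp only [Function.comp_apply]
    rw [Real.log_mul (by norm_num) hn.ne']
    ring
  refine ⟨fun n ↦ ⌊u n⌋₊, hmain.mono fun n h ↦ ⟨one_le_two.trans h.2.1, h.2.2.1, h.2.2.2.1⟩, ?_, ?_⟩
  · refine squeeze_zero_norm' ?_ hlim
    filter_upwards [hmain] with n ⟨_, hy2, _, _, h⟩
    rw [norm_div, Real.norm_of_nonneg (Real.sqrt_nonneg _), Real.norm_eq_abs]
    gcongr
    have h1 := hC _ hy2
    have h2 := abs_sub_le (∑ p ∈ Nat.primesLE ⌊u n⌋₊, (1 / p : ℝ))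
      (Real.log (Real.log ⌊u n⌋₊)) (s n)
    linarith
  · refine squeeze_zero_norm' ?_ hlim
    filter_upwards [hmain] with n ⟨hn2, hy2, _, _, h⟩
    rw [norm_div, Real.norm_of_nonneg (Real.sqrt_nonneg _), Real.norm_eq_abs]
    gcongr
    have h1 := hC _ hy2
    have h2 := hC _ hn2
    have h3 := abs_sub_le (∑ p ∈ Nat.primesLE n, (1 / p : ℝ)) (s n)
      (∑ p ∈ Nat.primesLE ⌊u n⌋₊, (1 / p : ℝ))
    have h4 := abs_sub_le (∑ p ∈ Nat.primesLE ⌊u n⌋₊, (1 / p : ℝ))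
      (Real.log (Real.log ⌊u n⌋₊)) (s n)
    rw [abs_sub_comm (s n)] at h3
    linarith

/-- The exponent of the characteristic function of a centred and normalised Poisson variable of
mean `Λ ∼ s` converges to that of the standard Gaussian. -/
lemma tendsto_poisson_exponent {s Λ : ℕ → ℝ} (hs : Tendsto s atTop atTop)
    (hr : Tendsto (fun n ↦ (Λ n - s n) / √(s n)) atTop (𝓝 0)) (t : ℝ) :
    Tendsto (fun n ↦ (Complex.exp (Complex.I * (t / √(s n) : ℝ)) - 1) * (Λ n : ℂ) -
      Complex.I * (t / √(s n) * s n : ℝ)) atTop (𝓝 (-(t : ℂ) ^ 2 / 2)) := by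
  have hsq : Tendsto (fun n ↦ √(s n)) atTop atTop := Real.tendsto_sqrt_atTop.comp hs
  have hθ : Tendsto (fun n ↦ t / √(s n)) atTop (𝓝 0) := tendsto_const_nhds.div_atTop hsq
  have hratio : Tendsto (fun n ↦ Λ n / s n) atTop (𝓝 1) := by
    have h : Tendsto (fun n ↦ 1 + (Λ n - s n) / √(s n) / √(s n)) atTop (𝓝 (1 + 0)) :=
      tendsto_const_nhds.add (hr.div_atTop hsq)
    rw [add_zero] at h
    refine h.congr' ?_
    filter_upwards [hs.eventually_gt_atTop 0] with n hn
    rw [div_div, Real.mul_self_sqrt hn.le]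
    field_simp
    ring
  have hcube : Tendsto (fun n ↦ (Complex.exp (Complex.I * (t / √(s n) : ℝ)) - 1 -
      Complex.I * (t / √(s n) : ℝ) + (t / √(s n) : ℝ) ^ 2 / 2) * (Λ n : ℂ)) atTop (𝓝 0) := by
    have hb : Tendsto (fun n ↦ |t| ^ 2 * |t / √(s n)| * |Λ n / s n|) atTop (𝓝 0) := by
      have h := (hθ.abs.const_mul (|t| ^ 2)).mul hratio.abs
      rwa [abs_zero, mul_zero, zero_mul] at h
    refine squeeze_zero_norm' ?_ hb
    filter_upwards [hs.eventually_gt_atTop 0,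
      hθ.eventually (Metric.ball_mem_nhds 0 one_pos)] with n hn hθn
    set θ := t / √(s n) with hθdef
    have hθ1 : |θ| ≤ 1 := by simpa using (mem_ball_zero_iff.1 hθn).le
    have hnorm : ‖Complex.I * (θ : ℂ)‖ = |θ| := by simp
    have h := Complex.exp_bound (x := Complex.I * (θ : ℂ)) (hnorm ▸ hθ1) (n := 3) (by norm_num)
    have e : Complex.exp (Complex.I * θ) - ∑ m ∈ range 3, (Complex.I * θ) ^ m / m.factorial =
        Complex.exp (Complex.I * θ) - 1 - Complex.I * θ + (θ : ℂ) ^ 2 / 2 := by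
      simp [sum_range_succ, Nat.factorial, mul_pow]
      ring
    rw [e, hnorm] at h
    have e2 : |θ| ^ 3 * |Λ n| = |t| ^ 2 * |θ| * |Λ n / s n| := by
      rw [abs_div (Λ n), abs_of_pos hn, pow_succ, hθdef, abs_div t,
        abs_of_nonneg (Real.sqrt_nonneg _), div_pow, Real.sq_sqrt hn.le]
      ring
    rw [norm_mul, Complex.norm_real, Real.norm_eq_abs, ← e2]
    gcongr
    refine h.trans (mul_le_of_le_one_right (by positivity) ?_)
    norm_num [Nat.factorial]
  have hlin : Tendsto (fun n ↦ Complex.I * (t * ((Λ n - s n) / √(s n)) : ℝ) -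
      (t ^ 2 * (Λ n / s n) : ℝ) / 2) atTop (𝓝 (Complex.I * (t * 0 : ℝ) - (t ^ 2 * 1 : ℝ) / 2)) :=
    (((hr.const_mul t).ofReal).const_mul Complex.I).sub
      (((hratio.const_mul (t ^ 2)).ofReal).div_const 2)
  have hsum := hcube.add hlin
  have e : (0 : ℂ) + (Complex.I * (t * 0 : ℝ) - (t ^ 2 * 1 : ℝ) / 2) = -(t : ℂ) ^ 2 / 2 := by
    push_cast; ring
  rw [e] at hsum
  refine hsum.congr' ?_
  filter_upwards [hs.eventually_gt_atTop 0] with n hn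
  have hsqn : ((√(s n) : ℝ) : ℂ) ^ 2 = s n := by exact_mod_cast Real.sq_sqrt hn.le
  push_cast
  rw [div_pow, hsqn]
  ring

/-- The number of prime divisors of `m` up to `y n`, centred and normalised by `log log n`, is
asymptotically Gaussian on `[1, n]`. -/
lemma tendsto_avg_exp_truncated {y : ℕ → ℕ}
    (hy : ∀ᶠ n : ℕ in atTop, 1 ≤ y n ∧ y n ≤ n ∧
        (y n : ℝ) ^ ⌊Real.log (Real.log n)⌋₊ / n ≤ Real.exp (-Real.log (Real.log n) / 2))
    (hr : Tendsto (fun n : ℕ ↦ (∑ p ∈ Nat.primesLE (y n), (1 / p : ℝ) - Real.log (Real.log n)) /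
        √(Real.log (Real.log n))) atTop (𝓝 0)) (t : ℝ) :
    Tendsto (fun n : ℕ ↦ (∑ m ∈ Icc 1 n, Complex.exp (Complex.I *
      (t * ((#{p ∈ Nat.primesLE (y n) | p ∣ m} - Real.log (Real.log n)) /
        √(Real.log (Real.log n))) : ℝ))) / n) atTop (𝓝 (Complex.exp (-(t : ℂ) ^ 2 / 2))) := by
  set s : ℕ → ℝ := fun n ↦ Real.log (Real.log n)
  have hs : Tendsto s atTop atTop := tendsto_log_log_natCast
  have hsq : Tendsto (fun n ↦ √(s n)) atTop atTop := Real.tendsto_sqrt_atTop.comp hs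
  set Λ : ℕ → ℝ := fun n ↦ ∑ p ∈ Nat.primesLE (y n), (1 / p : ℝ)
  set θ : ℕ → ℝ := fun n ↦ t / √(s n)
  have hθ : Tendsto θ atTop (𝓝 0) := tendsto_const_nhds.div_atTop hsq
  have hexp := (Complex.continuous_exp.tendsto _).comp (tendsto_poisson_exponent hs hr t)
  refine hexp.congr_dist ?_
  set K := ∑' m : ℕ, 1 / (m : ℝ) ^ 2
  have hbound : Tendsto (fun n ↦ 3 * Real.exp (√(s n) * (4 * |t| - √(s n) / 2)) + θ n ^ 2 * K)
      atTop (𝓝 0) := by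
    have h1 : Tendsto (fun x : ℝ ↦ x * (4 * |t| - x / 2)) atTop atBot := by
      refine tendsto_id.atTop_mul_atBot₀ ?_
      exact tendsto_const_nhds.add_atBot
        (tendsto_neg_atTop_atBot.comp (tendsto_id.atTop_div_const two_pos))
    have h2 := (Real.tendsto_exp_atBot.comp (h1.comp hsq)).const_mul 3
    have h3 := (hθ.pow 2).mul_const K
    simpa using h2.add h3
  refine squeeze_zero' (.of_forall fun _ ↦ dist_nonneg) ?_ hbound
  filter_upwards [hy, hs.eventually_gt_atTop 0, eventually_ne_atTop 0,
    hθ.eventually (Metric.ball_mem_nhds 0 one_pos),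
    hr.eventually (Metric.ball_mem_nhds 0 one_pos), hs.eventually_ge_atTop 1]
    with n ⟨hy1, hyn, hyk⟩ hs0 hn0 hθn hrn hs1
  have hθ1 : |θ n| ≤ 1 := by simpa using (mem_ball_zero_iff.1 hθn).le
  have hsqrt1 : 1 ≤ √(s n) := Real.one_le_sqrt.2 hs1
  have hss : √(s n) * √(s n) = s n := Real.mul_self_sqrt hs0.le
  have hΛ : Λ n ≤ 2 * s n := by
    have h1 : |(Λ n - s n) / √(s n)| < 1 := mem_ball_zero_iff.1 hrn
    have h2 := (abs_lt.1 h1).2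
    rw [div_lt_one (by linarith)] at h2
    nlinarith
  have hΛ0 : 0 ≤ Λ n := sum_nonneg fun p _ ↦ by positivity
  set z := Complex.exp (Complex.I * (θ n : ℝ)) - 1
  have hz : ‖z‖ ≤ |θ n| := Real.norm_exp_I_mul_ofReal_sub_one_le
  set c := Complex.exp (-(Complex.I * (θ n * s n : ℝ)))
  have hc : ‖c‖ = 1 := by
    have : -(Complex.I * (θ n * s n : ℝ)) = ((-(θ n * s n) : ℝ) : ℂ) * Complex.I := by
      push_cast; ring
    simp only [c, this]
    exact Complex.norm_exp_ofReal_mul_I _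
  have e1 : (∑ m ∈ Icc 1 n, Complex.exp (Complex.I *
      (t * ((#{p ∈ Nat.primesLE (y n) | p ∣ m} - s n) / √(s n)) : ℝ))) / n =
      c * ((∑ m ∈ Icc 1 n, ∏ p ∈ Nat.primesLE (y n), (1 + if p ∣ m then z else 0)) / n) := by
    rw [mul_div_assoc', mul_sum]
    congr 1
    refine sum_congr rfl fun m _ ↦ ?_
    have h1 : ∏ p ∈ Nat.primesLE (y n), (1 + if p ∣ m then z else 0) =
        Complex.exp (Complex.I * (θ n : ℝ)) ^ #{p ∈ Nat.primesLE (y n) | p ∣ m} := by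
      rw [← prod_const, prod_filter]
      refine prod_congr rfl fun p _ ↦ ?_
      split_ifs <;> simp [z]
    rw [h1, ← Complex.exp_nat_mul, ← Complex.exp_add]
    congr 1
    simp only [θ]
    push_cast
    ring
  have e2 : (Complex.exp ∘ fun n ↦ (Complex.exp (Complex.I * (t / √(s n) : ℝ)) - 1) * (Λ n : ℂ) -
      Complex.I * (t / √(s n) * s n : ℝ)) n = c * Complex.exp (z * (Λ n : ℝ)) := by
    simp only [Function.comp_apply, c]
    rw [← Complex.exp_add, sub_eq_neg_add]
  have hP (p : ℕ) (hp : p ∈ Nat.primesLE (y n)) : p.Prime := (Nat.mem_primesLE.1 hp).2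
  have b1 := norm_avg_sub_prod_le hP hy1 (fun p hp ↦ (Nat.mem_primesLE.1 hp).1) hn0 ⌊s n⌋₊ z
  have b2 := norm_prod_one_add_sub_exp_le (fun p hp ↦ (hP p hp).one_le) hθ1
  have b3 : ((y n : ℝ) ^ ⌊s n⌋₊ / n + (1 / 2) ^ ⌊s n⌋₊) *
      Real.exp (2 * ‖z‖ * ∑ p ∈ Nat.primesLE (y n), (1 / p : ℝ)) ≤
      3 * Real.exp (√(s n) * (4 * |t| - √(s n) / 2)) := by
    have hhalf : (1 / 2 : ℝ) ≤ Real.exp (-(1 / 2)) := by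
      have := Real.add_one_le_exp (-(1 / 2) : ℝ); linarith
    have hk : s n - 1 ≤ ⌊s n⌋₊ := (Nat.sub_one_lt_floor _).le
    have h1 : (1 / 2 : ℝ) ^ ⌊s n⌋₊ ≤ 2 * Real.exp (-s n / 2) := by
      calc (1 / 2 : ℝ) ^ ⌊s n⌋₊ ≤ Real.exp (-(1 / 2)) ^ ⌊s n⌋₊ := by gcongr
        _ = Real.exp (⌊s n⌋₊ * (-(1 / 2))) := by rw [← Real.exp_nat_mul]
        _ ≤ Real.exp (1 / 2 + -s n / 2) := Real.exp_le_exp.2 (by linarith)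
        _ = Real.exp (1 / 2) * Real.exp (-s n / 2) := Real.exp_add _ _
        _ ≤ 2 * Real.exp (-s n / 2) := by
          gcongr
          have h3 : Real.exp (1 / 2) * Real.exp (-(1 / 2)) = 1 := by
            rw [← Real.exp_add]; simp
          nlinarith [Real.exp_pos (1 / 2)]
    have h2 : 2 * ‖z‖ * Λ n ≤ √(s n) * (4 * |t|) := by
      calc 2 * ‖z‖ * Λ n ≤ 2 * |θ n| * (2 * s n) := by gcongr
        _ = √(s n) * (4 * |t|) := by
          simp only [θ]
          rw [abs_div, abs_of_nonneg (Real.sqrt_nonneg _)]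
          have : √(s n) ≠ 0 := by linarith
          field_simp
          rw [Real.sq_sqrt hs0.le]
          ring
    calc _ ≤ (Real.exp (-s n / 2) + 2 * Real.exp (-s n / 2)) * Real.exp (√(s n) * (4 * |t|)) := by
          gcongr
      _ = 3 * (Real.exp (-s n / 2) * Real.exp (√(s n) * (4 * |t|))) := by ring
      _ = _ := by
        rw [← Real.exp_add]
        congr 2
        nlinarith
  rw [dist_comm, dist_eq_norm, e2, e1, ← mul_sub, norm_mul, hc, one_mul]
  refine (norm_sub_le_norm_sub_add_norm_sub _
    (∏ p ∈ Nat.primesLE (y n), (1 + z / p)) _).trans ?_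
  exact add_le_add (b1.trans b3) b2

lemma norm_exp_I_mul_sub_exp_I_mul_le (a b : ℝ) :
    ‖Complex.exp (Complex.I * a) - Complex.exp (Complex.I * b)‖ ≤ |a - b| := by
  have e : Complex.exp (Complex.I * a) - Complex.exp (Complex.I * b) =
      Complex.exp (b * Complex.I) * (Complex.exp (Complex.I * (a - b : ℝ)) - 1) := by
    rw [mul_sub, ← Complex.exp_add, mul_one, mul_comm (b : ℂ)]
    congr 2
    push_cast
    ring
  rw [e, norm_mul, Complex.norm_exp_ofReal_mul_I, one_mul]
  exact Real.norm_exp_I_mul_ofReal_sub_one_le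

lemma norm_exp_I_mul_sub_exp_I_mul_le_two (a b : ℝ) :
    ‖Complex.exp (Complex.I * a) - Complex.exp (Complex.I * b)‖ ≤ 2 := by
  refine (norm_sub_le _ _).trans (le_of_eq ?_)
  rw [mul_comm, Complex.norm_exp_ofReal_mul_I, mul_comm, Complex.norm_exp_ofReal_mul_I]
  norm_num

lemma sum_card_filter_dvd_le (n : ℕ) (Q : Finset ℕ) :
    (∑ m ∈ Icc 1 n, (#{p ∈ Q | p ∣ m} : ℝ)) ≤ n * ∑ p ∈ Q, (1 / p : ℝ) := by
  have e : ∑ m ∈ Icc 1 n, #{p ∈ Q | p ∣ m} = ∑ p ∈ Q, n / p := by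
    simp_rw [card_filter]
    rw [sum_comm]
    refine sum_congr rfl fun p _ ↦ ?_
    rw [← card_filter, card_filter_dvd_Icc]
  rw [← Nat.cast_sum, e, Nat.cast_sum, mul_sum]
  refine sum_le_sum fun p _ ↦ ?_
  rw [mul_one_div]
  exact Nat.cast_div_le

lemma card_filter_sq_lt_le (n : ℕ) : (#{m ∈ Icc 1 n | m ^ 2 < n} : ℝ) ≤ √n := by
  have h : #{m ∈ Icc 1 n | m ^ 2 < n} ≤ Nat.sqrt n := by
    calc _ ≤ #(Icc 1 (Nat.sqrt n)) := by
          refine card_le_card fun m hm ↦ ?_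
          simp only [mem_filter, mem_Icc] at hm ⊢
          exact ⟨hm.1.1, Nat.le_sqrt'.2 hm.2.le⟩
      _ = Nat.sqrt n := by simp
  exact (Nat.cast_le.2 h).trans Real.nat_sqrt_le_real_sqrt

/-- The threshold `log log m + z √(log log m)` varies little for `√n ≤ m ≤ n`. -/
lemma abs_log_log_threshold_sub_le (z : ℝ) {n m : ℕ} (hn : 1 < Real.log (Real.log n))
    (hmn : m ≤ n) (hnm : n ≤ m ^ 2) :
    |Real.log (Real.log n) + z * √(Real.log (Real.log n)) -
      (Real.log (Real.log m) + z * √(Real.log (Real.log m)))| ≤ 1 + |z| := by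
  have hn0 : n ≠ 0 := by rintro rfl; norm_num at hn
  have hm0 : m ≠ 0 := by rintro rfl; simp at hnm; exact hn0 hnm
  have hlogn : 0 < Real.log n := by
    have h0 : 0 ≤ Real.log n := Real.log_natCast_nonneg n
    rcases h0.eq_or_lt with h | h
    · rw [← h] at hn; norm_num at hn
    · exact h
  have h1 : Real.log n / 2 ≤ Real.log m := by
    have : Real.log n ≤ 2 * Real.log m := by
      have h := Real.log_le_log (by positivity) (show (n : ℝ) ≤ (m : ℝ) ^ 2 by exact_mod_cast hnm)
      rwa [Real.log_pow] at h
    linarith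
  have h2 : Real.log m ≤ Real.log n :=
    Real.log_le_log (by positivity) (by exact_mod_cast hmn)
  have hlogm : 0 < Real.log m := by linarith
  set a := Real.log (Real.log n)
  set b := Real.log (Real.log m)
  have hba : b ≤ a := Real.log_le_log hlogm h2
  have hab : a ≤ b + 1 := by
    have h3 : a - Real.log 2 ≤ b := by
      rw [← Real.log_div hlogn.ne' two_ne_zero]
      exact Real.log_le_log (by positivity) h1
    have := Real.log_two_lt_d9
    linarith
  have hs1 : √b ≤ √a := Real.sqrt_le_sqrt hba
  have hs2 : √a ≤ √b + 1 := by
    refine Real.sqrt_le_iff.2 ⟨by positivity, ?_⟩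
    have := Real.sq_sqrt (show 0 ≤ b by linarith)
    nlinarith [Real.sqrt_nonneg b]
  have e : a + z * √a - (b + z * √b) = (a - b) + z * (√a - √b) := by ring
  rw [e]
  refine (abs_add_le _ _).trans (add_le_add ?_ ?_)
  · rw [abs_le]; constructor <;> linarith
  · rw [abs_mul]
    refine mul_le_of_le_one_right (abs_nonneg z) ?_
    rw [abs_le]; constructor <;> linarith

lemma card_primeFactors_eq_add (y n m : ℕ) (hyn : y ≤ n) (hm : m ∈ Icc 1 n) :
    #m.primeFactors = #{p ∈ Nat.primesLE y | p ∣ m} +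
      #{p ∈ Nat.primesLE n \ Nat.primesLE y | p ∣ m} := by
  have hm := mem_Icc.1 hm
  have e : m.primeFactors = {p ∈ Nat.primesLE n | p ∣ m} := by
    ext p
    simp only [Nat.mem_primeFactors, mem_filter, Nat.mem_primesLE]
    constructor
    · rintro ⟨hp, hpm, -⟩
      exact ⟨⟨(Nat.le_of_dvd hm.1 hpm).trans hm.2, hp⟩, hpm⟩
    · rintro ⟨⟨-, hp⟩, hpm⟩
      exact ⟨hp, hpm, by omega⟩
  rw [e, ← card_union_of_disjoint (disjoint_filter_filter disjoint_sdiff), ← filter_union,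
    union_sdiff_of_subset (Nat.primesLE_mono hyn)]

/-- For `n` large, `m ≤ n` satisfies `ω(m) - log log m ≤ z √(log log m)` if and only if
`shiftedDeviation z n m ≤ z`. -/
noncomputable def shiftedDeviation (z : ℝ) (n m : ℕ) : ℝ :=
  z + (#m.primeFactors - (Real.log (Real.log m) + z * √(Real.log (Real.log m)))) /
    √(Real.log (Real.log n))

lemma tendsto_avg_exp_shiftedDeviation (z t : ℝ) :
    Tendsto (fun n : ℕ ↦ (∑ m ∈ Icc 1 n,
      Complex.exp (Complex.I * (t * shiftedDeviation z n m : ℝ))) / n)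
      atTop (𝓝 (Complex.exp (-(t : ℂ) ^ 2 / 2))) := by
  obtain ⟨y, hy, hr, hd⟩ := exists_truncation
  set s : ℕ → ℝ := fun n ↦ Real.log (Real.log n)
  have hs : Tendsto s atTop atTop := tendsto_log_log_natCast
  have hsq : Tendsto (fun n ↦ √(s n)) atTop atTop := Real.tendsto_sqrt_atTop.comp hs
  refine (tendsto_avg_exp_truncated hy hr t).congr_dist ?_
  have hbound : Tendsto (fun n : ℕ ↦ |t| * ((∑ p ∈ Nat.primesLE n, (1 / p : ℝ) -
      ∑ p ∈ Nat.primesLE (y n), (1 / p : ℝ)) / √(s n)) + 2 / √(n : ℝ) +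
      |t| * (1 + |z|) / √(s n)) atTop (𝓝 0) := by
    have h1 := hd.const_mul |t|
    have h2 : Tendsto (fun n : ℕ ↦ 2 / √(n : ℝ)) atTop (𝓝 0) :=
      tendsto_const_nhds.div_atTop (Real.tendsto_sqrt_atTop.comp tendsto_natCast_atTop_atTop)
    have h3 : Tendsto (fun n ↦ |t| * (1 + |z|) / √(s n)) atTop (𝓝 0) :=
      tendsto_const_nhds.div_atTop hsq
    simpa using (h1.add h2).add h3
  refine squeeze_zero' (.of_forall fun _ ↦ dist_nonneg) ?_ hbound
  filter_upwards [hy, hs.eventually_gt_atTop 1, eventually_gt_atTop 0] with n ⟨_, hyn, _⟩ hs1 hn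
  have hn' : (0 : ℝ) < n := by positivity
  set σ := √(s n)
  have hσ : 0 < σ := Real.sqrt_pos.2 (by linarith)
  set Q := Nat.primesLE n \ Nat.primesLE (y n)
  have hpoint : ∀ m ∈ Icc 1 n,
      ‖Complex.exp (Complex.I * (t * shiftedDeviation z n m : ℝ)) - Complex.exp (Complex.I *
        (t * ((#{p ∈ Nat.primesLE (y n) | p ∣ m} - s n) / σ) : ℝ))‖ ≤
      |t| / σ * #{p ∈ Q | p ∣ m} + (if m ^ 2 < n then 2 else 0) + |t| * (1 + |z|) / σ := by
    intro m hm
    have hω : (#m.primeFactors : ℝ) = #{p ∈ Nat.primesLE (y n) | p ∣ m} + #{p ∈ Q | p ∣ m} := by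
      exact_mod_cast card_primeFactors_eq_add (y n) n m hyn hm
    refine (norm_sub_le_norm_sub_add_norm_sub _
      (Complex.exp (Complex.I * (t * ((#m.primeFactors - s n) / σ) : ℝ))) _).trans ?_
    rw [add_comm, add_assoc]
    refine add_le_add ?_ ?_
    · refine (norm_exp_I_mul_sub_exp_I_mul_le _ _).trans (le_of_eq ?_)
      have e : t * ((#m.primeFactors - s n) / σ) -
          t * ((#{p ∈ Nat.primesLE (y n) | p ∣ m} - s n) / σ) = t / σ * #{p ∈ Q | p ∣ m} := by
        rw [hω]; ring
      rw [e, abs_mul, abs_div, abs_of_pos hσ, Nat.abs_cast]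
    · split_ifs with h
      · exact (norm_exp_I_mul_sub_exp_I_mul_le_two _ _).trans
          (le_add_of_nonneg_right (by positivity))
      · rw [zero_add]
        refine (norm_exp_I_mul_sub_exp_I_mul_le _ _).trans ?_
        have h1 := abs_log_log_threshold_sub_le z hs1 (mem_Icc.1 hm).2 (not_lt.1 h)
        have e : t * shiftedDeviation z n m - t * ((#m.primeFactors - s n) / σ) =
            t * (s n + z * σ - (s m + z * √(s m))) / σ := by
          simp only [shiftedDeviation]
          change t * (z + (#m.primeFactors - (s m + z * √(s m))) / σ) - _ = _
          field_simp
          ring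
        rw [e, abs_div, abs_mul, abs_of_pos hσ]
        gcongr
  rw [dist_comm, dist_eq_norm, ← sub_div, ← sum_sub_distrib, norm_div, Complex.norm_natCast,
    div_le_iff₀ hn']
  refine (norm_sum_le _ _).trans ((sum_le_sum hpoint).trans ?_)
  rw [sum_add_distrib, sum_add_distrib, ← mul_sum, ← sum_filter, sum_const, sum_const,
    nsmul_eq_mul, nsmul_eq_mul, add_mul, add_mul]
  have hQ : ∑ p ∈ Q, (1 / p : ℝ) = ∑ p ∈ Nat.primesLE n, (1 / p : ℝ) -
      ∑ p ∈ Nat.primesLE (y n), (1 / p : ℝ) := by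
    rw [← sum_sdiff (Nat.primesLE_mono hyn)]; ring
  refine add_le_add (add_le_add ?_ ?_) ?_
  · rw [← hQ]
    refine (mul_le_mul_of_nonneg_left (sum_card_filter_dvd_le n Q) (by positivity)).trans_eq ?_
    ring
  · have h2 : 2 / √(n : ℝ) * n = √n * 2 := by
      rw [div_mul_eq_mul_div, div_eq_iff (by positivity)]
      linear_combination -2 * Real.mul_self_sqrt hn'.le
    rw [h2]
    gcongr
    exact card_filter_sq_lt_le n
  · simp [mul_comm]

open MeasureTheory ProbabilityTheory

/-- Empirical version of Lévy's continuity theorem with Gaussian limit. -/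
lemma tendsto_card_div_of_tendsto_avg_exp {Y : ℕ → ℕ → ℝ}
    (h : ∀ t : ℝ, Tendsto (fun n : ℕ ↦ (∑ m ∈ Icc 1 n, Complex.exp (Complex.I *
      (t * Y n m : ℝ))) / n) atTop (𝓝 (Complex.exp (-(t : ℂ) ^ 2 / 2)))) (z : ℝ) :
    Tendsto (fun n : ℕ ↦ (#{m ∈ Icc 1 n | Y n m ≤ z} : ℝ) / n) atTop
      (𝓝 ((gaussianReal 0 1).real (Set.Iic z))) := by
  set ν : ℕ → Measure ℝ := fun n ↦
    ∑ m ∈ Icc 1 (n + 1), ((n + 1 : ℕ) : ENNReal)⁻¹ • Measure.dirac (Y (n + 1) m)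
  have hν (n : ℕ) : IsProbabilityMeasure (ν n) := by
    constructor
    simp only [ν, Measure.coe_finsetSum, Finset.sum_apply, Measure.smul_apply, measure_univ,
      smul_eq_mul, mul_one, sum_const, Nat.card_Icc, Nat.add_sub_cancel, nsmul_eq_mul]
    exact ENNReal.mul_inv_cancel (by simp) (by simp)
  set P : ℕ → ProbabilityMeasure ℝ := fun n ↦ ⟨ν n, hν n⟩
  set G : ProbabilityMeasure ℝ := ⟨gaussianReal 0 1, inferInstance⟩
  have hP : Tendsto P atTop (𝓝 G) := by
    rw [ProbabilityMeasure.tendsto_iff_tendsto_charFun]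
    intro t
    have hG : charFun (G : Measure ℝ) t = Complex.exp (-(t : ℂ) ^ 2 / 2) := by
      change charFun (gaussianReal 0 1) t = _
      rw [charFun_gaussianReal]
      congr 1
      simp
      ring
    rw [hG]
    refine ((tendsto_add_atTop_iff_nat 1).2 (h t)).congr fun n ↦ ?_
    change _ = charFun (ν n) t
    rw [charFun_apply_real, integral_finsetSum_measure fun m _ ↦
      (integrable_dirac (by simp)).smul_measure (by simp)]
    rw [sum_div]
    refine sum_congr rfl fun m _ ↦ ?_
    rw [integral_smul_measure, integral_dirac, ENNReal.toReal_inv, ENNReal.toReal_natCast,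
      Complex.real_smul, div_eq_inv_mul]
    push_cast
    congr 2
    ring
  have hfr : G (frontier (Set.Iic z)) = 0 := by
    rw [frontier_Iic, ProbabilityMeasure.null_iff_toMeasure_null]
    have := nullSingletonClass_gaussianReal (μ := 0) (v := 1) one_ne_zero
    exact measure_singleton (μ := gaussianReal 0 1) z
  have hlim := ProbabilityMeasure.tendsto_measure_of_null_frontier_of_tendsto hP hfr
  rw [← tendsto_add_atTop_iff_nat 1]
  refine ((NNReal.tendsto_coe.2 hlim).congr fun n ↦ ?_)
  change (ν n).real (Set.Iic z) = _
  simp only [ν, Measure.real, Measure.coe_finsetSum, Finset.sum_apply, Measure.smul_apply,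
    smul_eq_mul]
  rw [← mul_sum, ENNReal.toReal_mul, ENNReal.toReal_inv, ENNReal.toReal_natCast, div_eq_inv_mul]
  congr 1
  simp only [measurableSet_Iic, Measure.dirac_apply', Set.indicator_apply, Set.mem_Iic,
    Pi.one_apply]
  rw [sum_boole, ENNReal.toReal_natCast]

lemma gaussianReal_real_Iic (z : ℝ) :
    (gaussianReal 0 1).real (Set.Iic z) =
      (1 / √(2 * Real.pi)) * ∫ t in Set.Iic z, Real.exp (-t ^ 2 / 2) := by
  rw [Measure.real, gaussianReal_apply_eq_integral _ one_ne_zero, ENNReal.toReal_ofReal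
    (integral_nonneg fun x ↦ gaussianPDFReal_nonneg 0 1 x), gaussianPDFReal_def,
    integral_const_mul]
  simp

end ErdosKac

/-- (Erdős–Kac theorem.) For every real `z`, the proportion of `3 ≤ m ≤ x` with
`ω(m) − log log m ≤ z·√(log log m)` tends, as `x → ∞`, to the standard Gaussian
distribution function `Φ(z) = (1/√(2π)) ∫_{−∞}^{z} e^{−t²/2} dt`, where `ω(m)`
is the number of distinct prime divisors of `m`. -/
theorem erdos_kac (z : ℝ) :
    Filter.Tendsto
      (fun x : ℕ =>
        (((Finset.Icc 3 x).filter (fun m : ℕ =>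
            (m.primeFactors.card : ℝ) - Real.log (Real.log m) ≤
              z * Real.sqrt (Real.log (Real.log m)))).card : ℝ) / (x : ℝ))
      Filter.atTop
      (nhds ((1 / Real.sqrt (2 * Real.pi)) *
        ∫ t in Set.Iic z, Real.exp (-t ^ 2 / 2))) := by
  rw [← ErdosKac.gaussianReal_real_Iic]
  have hlim := ErdosKac.tendsto_card_div_of_tendsto_avg_exp
    (ErdosKac.tendsto_avg_exp_shiftedDeviation z) z
  refine hlim.congr_dist ?_
  refine squeeze_zero' (.of_forall fun _ ↦ dist_nonneg) ?_
    (tendsto_const_div_atTop_nhds_zero_nat (2 : ℝ))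
  filter_upwards [ErdosKac.tendsto_log_log_natCast.eventually_gt_atTop 0] with n hn
  have hiff (m : ℕ) : ErdosKac.shiftedDeviation z n m ≤ z ↔
      (m.primeFactors.card : ℝ) - Real.log (Real.log m) ≤
        z * Real.sqrt (Real.log (Real.log m)) := by
    rw [ErdosKac.shiftedDeviation, add_le_iff_nonpos_right,
      div_le_iff₀ (Real.sqrt_pos.2 hn), zero_mul, sub_nonpos, sub_le_iff_le_add']
  simp_rw [hiff]
  set p : ℕ → Prop := fun m ↦ (m.primeFactors.card : ℝ) - Real.log (Real.log m) ≤
    z * Real.sqrt (Real.log (Real.log m))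
  have h1 : ((Finset.Icc 3 n).filter p).card ≤ ((Finset.Icc 1 n).filter p).card :=
    Finset.card_le_card (Finset.filter_subset_filter _ (Finset.Icc_subset_Icc_left (by norm_num)))
  have h2 : ((Finset.Icc 1 n).filter p).card ≤ ((Finset.Icc 3 n).filter p).card + 2 := by
    calc _ ≤ ((Finset.Icc 3 n).filter p ∪ {1, 2}).card := by
          refine Finset.card_le_card fun m hm ↦ ?_
          simp only [Finset.mem_union, Finset.mem_filter, Finset.mem_Icc, Finset.mem_insert,
            Finset.mem_singleton] at hm ⊢
          rcases le_or_gt 3 m with h | h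
          · exact Or.inl ⟨⟨h, hm.1.2⟩, hm.2⟩
          · right; omega
      _ ≤ _ := (Finset.card_union_le _ _).trans (by simp)
  have h1' : (((Finset.Icc 3 n).filter p).card : ℝ) ≤ ((Finset.Icc 1 n).filter p).card := by
    exact_mod_cast h1
  have h2' : (((Finset.Icc 1 n).filter p).card : ℝ) ≤ ((Finset.Icc 3 n).filter p).card + 2 := by
    exact_mod_cast h2
  rw [Real.dist_eq, ← sub_div, abs_div, Nat.abs_cast]
  gcongr
  rw [abs_le]
  constructor <;> linarith
end
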